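/- Fix β ∈ (−1,1). As Δ = 2−α → 0⁺, the mixed Fisher information of scale and characteristic exponent satisfies I_{σα}(α) / log(log(1/Δ)) → −1/2, i.e. I_{σα}(α) = −(1/2)·log(log(1/Δ))·(1 + o(1)), where I_{σα}(α) = ∫_ℝ f_σ(x;α,β)·f_α(x;α,β) / f(x;α,β) dx. -/

import Mathlib

open MeasureTheory Filter Set Topology Real

/-- Shift parameter ζ = −β·tan(πα/2) in Zolotarev's (M) parameterization. -/
noncomputable def zetaPar (α β : ℝ) : ℝ := -β * Real.tan (Real.pi * α / 2)

/-- Standard stable density in Zolotarev's (M) parameterization, via the inversion formula. -/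
noncomputable def stableDensity (α β x : ℝ) : ℝ :=
  (1 / Real.pi) *
    (∫ t in Set.Ioi (0 : ℝ),
      Complex.exp (-(Complex.I * (t : ℂ) * (x : ℂ))) *
        Complex.exp (-(((t ^ α : ℝ) : ℂ)) *
          (1 + Complex.I * (β : ℂ) * ((Real.tan (Real.pi * α / 2) : ℝ) : ℂ) *
            (((t ^ (1 - α) : ℝ) : ℂ) - 1)))).re

/-- The N(0,2) density f(y;2). -/
noncomputable def normalDensity (y : ℝ) : ℝ :=
  (1 / (2 * Real.sqrt Real.pi)) * Real.exp (-(y ^ 2) / 4)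

/-- Partial derivative of the stable density with respect to α. -/
noncomputable def fAlpha (α β x : ℝ) : ℝ := deriv (fun a : ℝ => stableDensity a β x) α

/-- Partial derivative of the stable density with respect to β. -/
noncomputable def fBeta (α β x : ℝ) : ℝ := deriv (fun b : ℝ => stableDensity α b x) β

/-- Derivative of the stable density in x. -/
noncomputable def fX (α β x : ℝ) : ℝ := deriv (stableDensity α β) x

/-- The scale score numerator f_σ = −f − x·f′. -/
noncomputable def fSig (α β x : ℝ) : ℝ := -stableDensity α β x - x * fX α β x

section Part1

/-! ### Pointwise estimates in the strip -/

noncomputable def tauP (a : ℝ) : ℝ := -Real.tan (Real.pi * a / 2)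

noncomputable def tauD (a : ℝ) : ℝ := -(Real.pi / 2) * (1 + tauP a ^ 2)

noncomputable def Lz (a β : ℝ) (ζ : ℂ) : ℂ :=
  -Complex.exp (a * ζ) + Complex.I * β * tauP a * (Complex.exp ζ - Complex.exp (a * ζ))

noncomputable def Dz (a β : ℝ) (ζ : ℂ) : ℂ :=
  -(ζ * Complex.exp (a * ζ)) + Complex.I * β * tauD a * (Complex.exp ζ - Complex.exp (a * ζ))
    - Complex.I * β * tauP a * (ζ * Complex.exp (a * ζ))

noncomputable def Ez (a β : ℝ) (ζ : ℂ) : ℂ := Lz a β ζ + Complex.exp (2 * ζ)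

lemma exp_sub_exp_le {a b : ℂ} {M : ℝ} (ha : a.re ≤ M) (hb : b.re ≤ M) :
    ‖Complex.exp a - Complex.exp b‖ ≤ Real.exp M * ‖a - b‖ := by
  have hc : Convex ℝ {z : ℂ | z.re ≤ M} := convex_halfSpace_re_le M
  refine Convex.norm_image_sub_le_of_norm_hasDerivWithin_le (𝕜 := ℂ) (f := Complex.exp)
    (f' := Complex.exp) (s := {z : ℂ | z.re ≤ M}) (fun x _ => (Complex.hasDerivAt_exp x).hasDerivWithinAt)
    ?_ hc hb ha
  intro x hx
  rw [Complex.norm_exp]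
  exact Real.exp_le_exp.2 hx

lemma exp_sub_exp_sub_le {a b : ℂ} {M R : ℝ} (hM : 0 ≤ M) (ha : a.re ≤ M) (hb : b.re ≤ M)
    (haR : ‖a‖ ≤ R) (hbR : ‖b‖ ≤ R) :
    ‖Complex.exp a - Complex.exp b - (a - b)‖ ≤ (Real.exp M * R) * ‖a - b‖ := by
  have hc : Convex ℝ ({z : ℂ | z.re ≤ M} ∩ Metric.closedBall 0 R) :=
    (convex_halfSpace_re_le M).inter (convex_closedBall 0 R)
  have := Convex.norm_image_sub_le_of_norm_hasDerivWithin_le (𝕜 := ℂ)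
    (f := fun z => Complex.exp z - z)
    (f' := fun z => Complex.exp z - 1) (s := {z : ℂ | z.re ≤ M} ∩ Metric.closedBall 0 R)
    (C := Real.exp M * R)
    (fun x _ => ((Complex.hasDerivAt_exp x).sub (hasDerivAt_id x)).hasDerivWithinAt)
    ?_ hc (x := b) (y := a) ⟨hb, by simpa using hbR⟩ ⟨ha, by simpa using haR⟩
  · rw [show Complex.exp a - Complex.exp b - (a - b) = (Complex.exp a - a) - (Complex.exp b - b) by ring]
    exact this
  intro x hx
  have h1 := exp_sub_exp_le (a := x) (b := 0) hx.1 (by simpa using hM)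
  simp only [Complex.exp_zero, sub_zero] at h1
  refine h1.trans ?_
  have : ‖x‖ ≤ R := by simpa using hx.2
  gcongr

lemma exp_sub_one_le {a : ℂ} {M : ℝ} (hM : 0 ≤ M) (ha : a.re ≤ M) :
    ‖Complex.exp a - 1‖ ≤ Real.exp M * ‖a‖ := by
  simpa using exp_sub_exp_le (a := a) (b := 0) ha (by simpa using hM)

lemma exp_sub_one_sub_le {a : ℂ} {M : ℝ} (hM : 0 ≤ M) (ha : a.re ≤ M) :
    ‖Complex.exp a - 1 - a‖ ≤ Real.exp M * ‖a‖ ^ 2 := by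
  have := exp_sub_exp_sub_le (a := a) (b := 0) (R := ‖a‖) hM ha (by simpa using hM) le_rfl (by simp)
  simp at this
  linarith [this, (by ring : Real.exp M * ‖a‖ ^ 2 = Real.exp M * ‖a‖ * ‖a‖)]

lemma tauP_eq (Δ : ℝ) : tauP (2 - Δ) = Real.tan (Real.pi * Δ / 2) := by
  unfold tauP
  rw [show Real.pi * (2 - Δ) / 2 = Real.pi - Real.pi * Δ / 2 by ring, Real.tan_pi_sub]; ring

lemma tan_bounds {y : ℝ} (h0 : 0 ≤ y) (h1 : y ≤ 1 / 2) :
    0 ≤ Real.tan y - y ∧ Real.tan y - y ≤ y ^ 3 := by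
  constructor
  · rcases h0.eq_or_lt with h | h
    · simp [← h]
    · linarith [Real.lt_tan h (by linarith [Real.pi_gt_three])]
  · have hc : 1 - y ^ 2 / 2 ≤ Real.cos y := Real.one_sub_sq_div_two_le_cos
    have hcp : 0 < Real.cos y := by nlinarith
    rw [Real.tan_eq_sin_div_cos]
    have : Real.sin y / Real.cos y ≤ y + y ^ 3 := by
      rw [div_le_iff₀ hcp]
      have := Real.sin_le h0
      calc Real.sin y ≤ y := this
        _ ≤ (y + y ^ 3) * (1 - y ^ 2 / 2) := by
          have h3 : 0 ≤ y ^ 3 := by positivity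
          have h4 : y ^ 2 ≤ 1 := by nlinarith
          nlinarith [mul_nonneg h3 (sub_nonneg.2 h4)]
        _ ≤ _ := by gcongr
    linarith

lemma tauP_bounds {Δ : ℝ} (h0 : 0 ≤ Δ) (h1 : Δ ≤ 1 / 100) :
    0 ≤ tauP (2 - Δ) ∧ tauP (2 - Δ) ≤ 2 * Δ := by
  have hp := Real.pi_gt_three
  have hp' := Real.pi_lt_d2
  have hy0 : 0 ≤ Real.pi * Δ / 2 := by positivity
  have hy2 : Real.pi * Δ / 2 ≤ 1.6 * Δ := by nlinarith
  have := tan_bounds hy0 (by linarith)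
  rw [tauP_eq]
  constructor
  · linarith
  · have h3 : (Real.pi * Δ / 2) ^ 3 ≤ (1.6 * Δ) ^ 3 := by gcongr
    have h6 : Δ ^ 2 ≤ 1 / 100 := by nlinarith
    have : Δ ^ 3 ≤ Δ * (1/100) := by nlinarith [mul_le_mul_of_nonneg_left h6 h0]
    nlinarith

lemma tauD_bounds {Δ : ℝ} (h0 : 0 ≤ Δ) (h1 : Δ ≤ 1 / 100) :
    |tauD (2 - Δ)| ≤ 2 := by
  have hp := Real.pi_gt_three
  have hp' := Real.pi_lt_d2
  obtain ⟨h2, h3⟩ := tauP_bounds h0 h1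
  unfold tauD
  rw [abs_mul, abs_neg, abs_of_pos (by positivity : 0 < Real.pi / 2), abs_of_nonneg (by positivity)]
  have : tauP (2 - Δ) ^ 2 ≤ (1/50)^2 := by gcongr; linarith
  nlinarith

lemma tauQ_bounds {Δ : ℝ} (h0 : 0 < Δ) (h1 : Δ ≤ 1 / 100) :
    |tauD (2 - Δ) + tauP (2 - Δ) / Δ| ≤ 10 * Δ := by
  have hp := Real.pi_gt_three
  have hp' := Real.pi_lt_d2
  obtain ⟨h2, h3⟩ := tauP_bounds h0.le h1
  have hy0 : 0 ≤ Real.pi * Δ / 2 := by positivity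
  have hy2 : Real.pi * Δ / 2 ≤ 1.6 * Δ := by nlinarith
  have h4 := tan_bounds hy0 (by linarith)
  rw [← tauP_eq] at h4
  have h5 : (Real.pi * Δ / 2) ^ 3 ≤ (1.6 * Δ) ^ 3 := by gcongr
  have e : tauD (2 - Δ) + tauP (2 - Δ) / Δ =
      (tauP (2 - Δ) - Real.pi * Δ / 2) / Δ - Real.pi / 2 * tauP (2 - Δ) ^ 2 := by
    unfold tauD; field_simp; ring
  rw [e]
  have h6 : (tauP (2 - Δ) - Real.pi * Δ / 2) / Δ ≤ 5 * Δ := by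
    rw [div_le_iff₀ h0]
    nlinarith [mul_pos h0 h0]
  have h7 : 0 ≤ (tauP (2 - Δ) - Real.pi * Δ / 2) / Δ := div_nonneg h4.1 h0.le
  have h8 : Real.pi / 2 * tauP (2 - Δ) ^ 2 ≤ 5 * Δ := by
    have : tauP (2 - Δ) ^ 2 ≤ (2 * Δ)^2 := by gcongr
    nlinarith
  have h9 : 0 ≤ Real.pi / 2 * tauP (2 - Δ) ^ 2 := by positivity
  rw [abs_le]; constructor <;> linarith

/-- absorbing powers -/
lemma absorb (r p : ℝ) (hp : 7 / 4 ≤ p) (hp2 : p ≤ 2) :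
    (1 + |r|) ^ 2 * Real.exp (p * r) ≤ 64 * (Real.exp (3 / 2 * r) + Real.exp (3 * r)) := by
  have h1 : 1 + |r| ≤ 8 * Real.exp (|r| / 8) := by
    have := Real.add_one_le_exp (|r| / 8)
    have := abs_nonneg r
    linarith
  have h2 : (1 + |r|) ^ 2 ≤ 64 * Real.exp (|r| / 4) := by
    have e : Real.exp (|r| / 4) = Real.exp (|r| / 8) ^ 2 := by
      rw [← Real.exp_nat_mul]; congr 1; push_cast; ring
    rw [e]
    have : 0 ≤ 1 + |r| := by positivity
    nlinarith [Real.exp_pos (|r|/8)]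
  have h3 : Real.exp (|r| / 4) * Real.exp (p * r) ≤ Real.exp (3 / 2 * r) + Real.exp (3 * r) := by
    rw [← Real.exp_add]
    rcases le_total 0 r with h | h
    · rw [abs_of_nonneg h]
      have : Real.exp (r / 4 + p * r) ≤ Real.exp (3 * r) := by
        apply Real.exp_le_exp.2; nlinarith
      linarith [Real.exp_pos (3 / 2 * r)]
    · rw [abs_of_nonpos h]
      have : Real.exp (-r / 4 + p * r) ≤ Real.exp (3 / 2 * r) := by
        apply Real.exp_le_exp.2; nlinarith
      linarith [Real.exp_pos (3 * r)]
  calc _ ≤ 64 * Real.exp (|r| / 4) * Real.exp (p * r) := by gcongr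
    _ = 64 * (Real.exp (|r| / 4) * Real.exp (p * r)) := by ring
    _ ≤ _ := by gcongr

lemma exp_mono_mid (r p : ℝ) {q s : ℝ} (hp : q ≤ p) (hp2 : p ≤ s) :
    Real.exp (p * r) ≤ Real.exp (q * r) + Real.exp (s * r) := by
  rcases le_total 0 r with h | h
  · have : Real.exp (p * r) ≤ Real.exp (s * r) := by
        apply Real.exp_le_exp.2; nlinarith
    linarith [Real.exp_pos (q * r)]
  · have : Real.exp (p * r) ≤ Real.exp (q * r) := by
        apply Real.exp_le_exp.2; nlinarith
    linarith [Real.exp_pos (s * r)]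

lemma norm_exp_mul (a : ℝ) (ζ : ℂ) : ‖Complex.exp (a * ζ)‖ = Real.exp (a * ζ.re) := by
  rw [Complex.norm_exp]; simp

lemma norm_exp_two (ζ : ℂ) : ‖Complex.exp (2 * ζ)‖ = Real.exp (2 * ζ.re) := by
  rw [Complex.norm_exp]; simp

structure Strip (Δ β : ℝ) (ζ : ℂ) : Prop where
  h0 : 0 ≤ Δ
  h1 : Δ ≤ 1 / 100
  hb : |β| ≤ 1
  im0 : ζ.im ≤ 0
  im1 : -(Real.pi / 6) ≤ ζ.im

variable {Δ β : ℝ} {ζ : ℂ}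

lemma Strip.norm_le (h : Strip Δ β ζ) : ‖ζ‖ ≤ 1 + |ζ.re| := by
  have := Complex.norm_le_abs_re_add_abs_im ζ
  have h2 : |ζ.im| ≤ 1 := by
    rw [abs_le]; constructor <;> linarith [h.im0, h.im1, Real.pi_lt_d2]
  linarith

lemma norm_Ib {β t : ℝ} (hb : |β| ≤ 1) : ‖Complex.I * (β : ℂ) * (t : ℂ)‖ ≤ |t| := by
  simp only [norm_mul, Complex.norm_I, one_mul, Complex.norm_real, Real.norm_eq_abs]
  nlinarith [abs_nonneg t]

/-- first and second order differences -/
lemma Strip.diff1 (h : Strip Δ β ζ) :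
    ‖Complex.exp (2 * ζ) - Complex.exp ((2 - Δ : ℝ) * ζ)‖ ≤
      128 * Δ * (Real.exp (3 / 2 * ζ.re) + Real.exp (3 * ζ.re)) := by
  have e : Complex.exp (2 * ζ) - Complex.exp ((2 - Δ : ℝ) * ζ) =
      Complex.exp ((2 - Δ : ℝ) * ζ) * (Complex.exp (Δ * ζ) - 1) := by
    rw [mul_sub, ← Complex.exp_add]; push_cast; ring_nf
  rw [e, norm_mul, norm_exp_mul]
  have h2 := exp_sub_one_le (a := Δ * ζ) (M := max 0 (Δ * ζ.re)) (le_max_left _ _)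
    (by simp)
  have h3 : Real.exp (max 0 (Δ * ζ.re)) ≤ 1 + Real.exp (Δ * ζ.re) := by
    rcases max_cases 0 (Δ * ζ.re) with h | h <;> rw [h.1] <;> simp [Real.exp_nonneg]
  have h4 : ‖(Δ : ℂ) * ζ‖ ≤ Δ * (1 + |ζ.re|) := by
    rw [norm_mul, Complex.norm_real, Real.norm_eq_abs, abs_of_nonneg h.h0]
    exact mul_le_mul_of_nonneg_left h.norm_le h.h0
  have a1 := absorb ζ.re (2 - Δ) (by linarith [h.h1]) (by linarith [h.h0])
  have a2 := absorb ζ.re 2 (by linarith [h.h1]) (by linarith [h.h0])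
  have hd := h.h0
  have e2 : Real.exp ((2 - Δ) * ζ.re) * Real.exp (Δ * ζ.re) = Real.exp (2 * ζ.re) := by
    rw [← Real.exp_add]; ring_nf
  have hone : 1 + |ζ.re| ≤ (1 + |ζ.re|) ^ 2 := by nlinarith [abs_nonneg ζ.re]
  calc _ ≤ Real.exp ((2 - Δ) * ζ.re) * ((1 + Real.exp (Δ * ζ.re)) * (Δ * (1 + |ζ.re|)^2)) := by
        gcongr
        refine h2.trans ?_
        gcongr
        exact h4.trans (by gcongr)
    _ = Δ * ((1 + |ζ.re|)^2 * Real.exp ((2 - Δ) * ζ.re) +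
          (1 + |ζ.re|)^2 * (Real.exp ((2 - Δ) * ζ.re) * Real.exp (Δ * ζ.re))) := by ring
    _ ≤ Δ * (64 * (Real.exp (3 / 2 * ζ.re) + Real.exp (3 * ζ.re)) +
        64 * (Real.exp (3 / 2 * ζ.re) + Real.exp (3 * ζ.re))) := by
        rw [e2]; gcongr
    _ = _ := by ring

lemma Strip.diff2 (h : Strip Δ β ζ) :
    ‖Complex.exp (2 * ζ) - Complex.exp ((2 - Δ : ℝ) * ζ) - Δ * (ζ * Complex.exp ((2 - Δ : ℝ) * ζ))‖ ≤
      128 * Δ ^ 2 * (Real.exp (3 / 2 * ζ.re) + Real.exp (3 * ζ.re)) := by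
  have e : Complex.exp (2 * ζ) - Complex.exp ((2 - Δ : ℝ) * ζ)
      - Δ * (ζ * Complex.exp ((2 - Δ : ℝ) * ζ)) =
      Complex.exp ((2 - Δ : ℝ) * ζ) * (Complex.exp (Δ * ζ) - 1 - Δ * ζ) := by
    rw [mul_sub, mul_sub, ← Complex.exp_add]; push_cast; ring_nf
  rw [e, norm_mul, norm_exp_mul]
  have h2 := exp_sub_one_sub_le (a := Δ * ζ) (M := max 0 (Δ * ζ.re)) (le_max_left _ _)
    (by simp)
  have h3 : Real.exp (max 0 (Δ * ζ.re)) ≤ 1 + Real.exp (Δ * ζ.re) := by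
    rcases max_cases 0 (Δ * ζ.re) with h | h <;> rw [h.1] <;> simp [Real.exp_nonneg]
  have h4 : ‖(Δ : ℂ) * ζ‖ ≤ Δ * (1 + |ζ.re|) := by
    rw [norm_mul, Complex.norm_real, Real.norm_eq_abs, abs_of_nonneg h.h0]
    exact mul_le_mul_of_nonneg_left h.norm_le h.h0
  have a1 := absorb ζ.re (2 - Δ) (by linarith [h.h1]) (by linarith [h.h0])
  have a2 := absorb ζ.re 2 (by linarith [h.h1]) (by linarith [h.h0])
  have hd := h.h0
  have e2 : Real.exp ((2 - Δ) * ζ.re) * Real.exp (Δ * ζ.re) = Real.exp (2 * ζ.re) := by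
    rw [← Real.exp_add]; ring_nf
  calc _ ≤ Real.exp ((2 - Δ) * ζ.re) * ((1 + Real.exp (Δ * ζ.re)) * (Δ * (1 + |ζ.re|))^2) := by
        gcongr
        refine h2.trans ?_
        gcongr
    _ = Δ^2 * ((1 + |ζ.re|)^2 * Real.exp ((2 - Δ) * ζ.re) +
          (1 + |ζ.re|)^2 * (Real.exp ((2 - Δ) * ζ.re) * Real.exp (Δ * ζ.re))) := by ring
    _ ≤ Δ^2 * (64 * (Real.exp (3 / 2 * ζ.re) + Real.exp (3 * ζ.re)) +
        64 * (Real.exp (3 / 2 * ζ.re) + Real.exp (3 * ζ.re))) := by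
        rw [e2]; gcongr
    _ = _ := by ring

lemma Strip.zl (h : Strip Δ β ζ) :
    ‖ζ * Complex.exp ((2 - Δ : ℝ) * ζ)‖ ≤ 64 * (Real.exp (3 / 2 * ζ.re) + Real.exp (3 * ζ.re)) := by
  rw [norm_mul, norm_exp_mul]
  have a1 := absorb ζ.re (2 - Δ) (by linarith [h.h1]) (by linarith [h.h0])
  have hone : 1 + |ζ.re| ≤ (1 + |ζ.re|) ^ 2 := by nlinarith [abs_nonneg ζ.re]
  refine le_trans ?_ a1
  gcongr
  exact h.norm_le.trans hone

lemma Strip.za (h : Strip Δ β ζ) :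
    ‖Complex.exp ((2 - Δ : ℝ) * ζ)‖ ≤ Real.exp (3 / 2 * ζ.re) + Real.exp (3 * ζ.re) := by
  rw [norm_exp_mul]
  exact exp_mono_mid _ _ (by linarith [h.h1]) (by linarith [h.h0])

lemma Strip.z2 (ζ : ℂ) :
    ‖Complex.exp (2 * ζ)‖ ≤ Real.exp (3 / 2 * ζ.re) + Real.exp (3 * ζ.re) := by
  rw [norm_exp_two]
  exact exp_mono_mid _ _ (by norm_num) (by norm_num)

lemma Strip.tau (h : Strip Δ β ζ) : ‖Complex.I * (β : ℂ) * (tauP (2 - Δ) : ℂ)‖ ≤ 2 * Δ := by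
  obtain ⟨h2, h3⟩ := tauP_bounds h.h0 h.h1
  refine (norm_Ib h.hb).trans ?_
  rwa [abs_of_nonneg h2]

lemma Strip.tauD (h : Strip Δ β ζ) : ‖Complex.I * (β : ℂ) * (tauD (2 - Δ) : ℂ)‖ ≤ 2 :=
  (norm_Ib h.hb).trans (tauD_bounds h.h0 h.h1)

lemma pow_three_halves (r : ℝ) : Real.exp (3 / 2 * r) ≤ Real.exp r + Real.exp (3 * r) := by
  simpa using exp_mono_mid r (3 / 2) (q := 1) (s := 3) (by norm_num) (by norm_num)

lemma Strip.Ebd (h : Strip Δ β ζ) :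
    ‖Ez (2 - Δ) β ζ‖ ≤ 300 * Δ * (Real.exp ζ.re + Real.exp (3 * ζ.re)) := by
  have e : Ez (2 - Δ) β ζ = (Complex.exp (2 * ζ) - Complex.exp ((2 - Δ : ℝ) * ζ)) +
      Complex.I * β * tauP (2 - Δ) * (Complex.exp ζ - Complex.exp ((2 - Δ : ℝ) * ζ)) := by
    unfold Ez Lz; ring
  rw [e]
  have h1 := h.diff1
  have h2 := h.tau
  have h3 := h.za
  have h4 : ‖Complex.exp ζ - Complex.exp ((2 - Δ : ℝ) * ζ)‖ ≤ Real.exp ζ.re +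
      (Real.exp (3 / 2 * ζ.re) + Real.exp (3 * ζ.re)) := by
    refine (norm_sub_le _ _).trans ?_
    rw [Complex.norm_exp]; gcongr
  have h5 := pow_three_halves ζ.re
  have hd := h.h0
  have p1 := Real.exp_pos ζ.re
  have p3 := Real.exp_pos (3 * ζ.re)
  calc _ ≤ 128 * Δ * (Real.exp (3 / 2 * ζ.re) + Real.exp (3 * ζ.re)) + 2 * Δ * (Real.exp ζ.re +
      (Real.exp (3 / 2 * ζ.re) + Real.exp (3 * ζ.re))) := by
        refine (norm_add_le _ _).trans ?_
        rw [norm_mul]; gcongr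
    _ ≤ 128 * Δ * ((Real.exp ζ.re + Real.exp (3 * ζ.re)) + Real.exp (3 * ζ.re)) + 2 * Δ * (Real.exp ζ.re +
      ((Real.exp ζ.re + Real.exp (3 * ζ.re)) + Real.exp (3 * ζ.re))) := by gcongr
    _ ≤ _ := by nlinarith [mul_nonneg hd p1.le, mul_nonneg hd p3.le]

lemma Strip.Lbd (h : Strip Δ β ζ) :
    ‖Lz (2 - Δ) β ζ‖ ≤ 2 * (Δ * Real.exp ζ.re + Real.exp (3 / 2 * ζ.re) + Real.exp (3 * ζ.re)) := by
  have h2 := h.tau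
  have h3 := h.za
  have hd := h.h0
  have hd1 := h.h1
  have p1 := Real.exp_pos ζ.re
  have p2 := Real.exp_pos (3 / 2 * ζ.re)
  have p3 := Real.exp_pos (3 * ζ.re)
  calc _ ≤ (Real.exp (3 / 2 * ζ.re) + Real.exp (3 * ζ.re)) + 2 * Δ * (Real.exp ζ.re +
      (Real.exp (3 / 2 * ζ.re) + Real.exp (3 * ζ.re))) := by
        refine (norm_add_le _ _).trans ?_
        rw [norm_mul, norm_neg]; gcongr
        refine (norm_sub_le _ _).trans ?_
        rw [Complex.norm_exp]; gcongr
    _ ≤ _ := by nlinarith [mul_nonneg (sub_nonneg.2 hd1) p2.le, mul_nonneg (sub_nonneg.2 hd1) p3.le]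

lemma re_exp_ge {c : ℝ} (hc0 : 0 ≤ c) (hc : c ≤ 2) (h0 : ζ.im ≤ 0) (h1 : -(Real.pi / 6) ≤ ζ.im) :
    Real.exp (c * ζ.re) / 2 ≤ (Complex.exp (c * ζ)).re := by
  rw [Complex.exp_re]
  simp only [Complex.re_ofReal_mul, Complex.im_ofReal_mul]
  have : (1:ℝ) / 2 ≤ Real.cos (c * ζ.im) := by
    rw [← Real.cos_pi_div_three, ← Real.cos_neg (c * ζ.im)]
    apply Real.cos_le_cos_of_nonneg_of_le_pi <;> nlinarith [Real.pi_pos]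
  nlinarith [Real.exp_pos (c * ζ.re)]

lemma Strip.Lre (h : Strip Δ β ζ) : (Lz (2 - Δ) β ζ).re ≤ 2 - Real.exp ζ.re / 8 := by
  have h2 := h.tau
  have hd := h.h0
  have hd1 := h.h1
  have h3 := re_exp_ge (c := 2 - Δ) (by linarith) (by linarith) h.im0 h.im1
  have h4 : (Complex.I * β * tauP (2 - Δ) * (Complex.exp ζ - Complex.exp ((2 - Δ : ℝ) * ζ))).re ≤
      1 / 50 * (Real.exp ζ.re + Real.exp ((2 - Δ) * ζ.re)) := by
    refine (Complex.re_le_norm _).trans ?_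
    rw [norm_mul]
    have : ‖Complex.exp ζ - Complex.exp ((2 - Δ : ℝ) * ζ)‖ ≤
        (Real.exp ζ.re + Real.exp ((2 - Δ) * ζ.re)) := by
      refine (norm_sub_le _ _).trans ?_
      rw [Complex.norm_exp, norm_exp_mul]
    gcongr
    linarith
  have h5 : Real.exp ζ.re ≤ 1 + Real.exp ((2 - Δ) * ζ.re) := by
    have := exp_mono_mid ζ.re 1 (q := 0) (s := 2 - Δ) (by norm_num) (by linarith)
    simpa using this
  unfold Lz
  rw [Complex.add_re, Complex.neg_re]
  have p := Real.exp_pos ((2 - Δ) * ζ.re)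
  linarith

lemma Strip.z2re (h : Strip Δ β ζ) : (-Complex.exp (2 * ζ)).re ≤ 2 - Real.exp ζ.re / 8 := by
  have h3 := re_exp_ge (c := 2) (by linarith) (by linarith) h.im0 h.im1
  have h5 : Real.exp ζ.re ≤ 1 + Real.exp (2 * ζ.re) := by
    have := exp_mono_mid ζ.re 1 (q := 0) (s := 2) (by norm_num) (by norm_num)
    simpa using this
  rw [Complex.neg_re]
  have p := Real.exp_pos (2 * ζ.re)
  push_cast at h3
  linarith

lemma Strip.expL (h : Strip Δ β ζ) : ‖Complex.exp (Lz (2 - Δ) β ζ)‖ ≤ Real.exp (2 - Real.exp ζ.re / 8) := by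
  rw [Complex.norm_exp]; exact Real.exp_le_exp.2 h.Lre

lemma Strip.LE (ζ : ℂ) : Lz (2 - Δ) β ζ - (-Complex.exp (2 * ζ)) = Ez (2 - Δ) β ζ := by
  unfold Ez; ring

lemma Strip.P5 (h : Strip Δ β ζ) :
    ‖Complex.exp (Lz (2 - Δ) β ζ) - Complex.exp (-Complex.exp (2 * ζ))‖ ≤
      Real.exp (2 - Real.exp ζ.re / 8) * (300 * Δ * (Real.exp ζ.re + Real.exp (3 * ζ.re))) := by
  refine (exp_sub_exp_le h.Lre h.z2re).trans ?_
  rw [Strip.LE]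
  gcongr
  exact h.Ebd

lemma exp_two_lt : Real.exp 2 < 8 := by
  have := Real.exp_one_lt_d9
  have e : Real.exp 2 = Real.exp 1 ^ 2 := by rw [← Real.exp_nat_mul]; norm_num
  rw [e]; nlinarith [Real.exp_pos 1]

lemma Strip.P6 (h : Strip Δ β ζ) :
    ‖Complex.exp (Lz (2 - Δ) β ζ) - Complex.exp (-Complex.exp (2 * ζ)) - Ez (2 - Δ) β ζ‖ ≤
      (8 * (3 * (Δ * Real.exp ζ.re + Real.exp (3 / 2 * ζ.re) + Real.exp (3 * ζ.re)))) *
        (300 * Δ * (Real.exp ζ.re + Real.exp (3 * ζ.re))) := by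
  have hL := h.Lbd
  have h2 := Strip.z2 ζ
  have hd := h.h0
  have p0 := Real.exp_pos ζ.re
  have p2 := Real.exp_pos (3 / 2 * ζ.re)
  have p3 := Real.exp_pos (3 * ζ.re)
  have p4 : 0 ≤ Δ * Real.exp ζ.re := by positivity
  have := exp_sub_exp_sub_le (a := Lz (2 - Δ) β ζ) (b := -Complex.exp (2 * ζ)) (M := 2)
    (R := 3 * (Δ * Real.exp ζ.re + Real.exp (3 / 2 * ζ.re) + Real.exp (3 * ζ.re))) (by norm_num)
    (by linarith [h.Lre]) (by linarith [h.z2re]) (by linarith) (by rw [norm_neg]; linarith)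
  rw [Strip.LE] at this
  refine this.trans ?_
  have h8 := exp_two_lt.le
  gcongr
  exact h.Ebd

lemma Strip.P7 (h : Strip Δ β ζ) :
    ‖Complex.exp (Lz (2 - Δ) β ζ) - 1‖ ≤
      8 * (2 * (Δ * Real.exp ζ.re + Real.exp (3 / 2 * ζ.re) + Real.exp (3 * ζ.re))) := by
  have p0 := Real.exp_pos ζ.re
  have := exp_sub_one_le (a := Lz (2 - Δ) β ζ) (M := 2) (by norm_num) (by linarith [h.Lre])
  refine this.trans ?_
  have h8 := exp_two_lt.le
  gcongr
  exact h.Lbd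

lemma Strip.Dbd (h : Strip Δ β ζ) :
    ‖Dz (2 - Δ) β ζ‖ ≤ 300 * (Real.exp ζ.re + Real.exp (3 * ζ.re)) := by
  have h1 := h.zl
  have h2 := h.tau
  have h2' := h.tauD
  have h3 := h.za
  have h4 : ‖Complex.exp ζ - Complex.exp ((2 - Δ : ℝ) * ζ)‖ ≤ Real.exp ζ.re +
      (Real.exp (3 / 2 * ζ.re) + Real.exp (3 * ζ.re)) := by
    refine (norm_sub_le _ _).trans ?_
    rw [Complex.norm_exp]; gcongr
  have h5 := pow_three_halves ζ.re
  have hd := h.h0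
  have hd1 := h.h1
  have p1 := Real.exp_pos ζ.re
  have p3 := Real.exp_pos (3 * ζ.re)
  have p2 := Real.exp_pos (3 / 2 * ζ.re)
  calc _ ≤ 64 * (Real.exp (3 / 2 * ζ.re) + Real.exp (3 * ζ.re)) + 2 * (Real.exp ζ.re +
      (Real.exp (3 / 2 * ζ.re) + Real.exp (3 * ζ.re))) + 1 * (64 * (Real.exp (3 / 2 * ζ.re) + Real.exp (3 * ζ.re))) := by
        refine (norm_sub_le _ _).trans ?_
        rw [norm_mul (Complex.I * (β:ℂ) * (tauP (2 - Δ) : ℂ))]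
        gcongr
        · refine (norm_add_le _ _).trans ?_
          rw [norm_neg, norm_mul (Complex.I * (β:ℂ) * (_root_.tauD (2 - Δ) : ℂ))]
          gcongr
        · linarith
    _ ≤ _ := by linarith

noncomputable def D1z (Δ β : ℝ) (ζ : ℂ) : ℂ :=
  -(Ez (2 - Δ) β ζ / Δ) + Complex.I * β * ((tauD (2 - Δ) + tauP (2 - Δ) / Δ : ℝ) : ℂ) * Complex.exp ζ

lemma Strip.q (h : Strip Δ β ζ) (hp : 0 < Δ) :
    ‖Complex.I * (β : ℂ) * ((_root_.tauD (2 - Δ) + tauP (2 - Δ) / Δ : ℝ) : ℂ)‖ ≤ 10 * Δ :=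
  (norm_Ib h.hb).trans (tauQ_bounds hp h.h1)

lemma Strip.D1bd (h : Strip Δ β ζ) (hp : 0 < Δ) :
    ‖D1z Δ β ζ‖ ≤ 400 * (Real.exp ζ.re + Real.exp (3 * ζ.re)) := by
  have hE := h.Ebd
  have hq := h.q hp
  have hd1 := h.h1
  have p1 := Real.exp_pos ζ.re
  have p3 := Real.exp_pos (3 * ζ.re)
  calc _ ≤ 300 * (Real.exp ζ.re + Real.exp (3 * ζ.re)) + 10 * Δ * Real.exp ζ.re := by
        refine (norm_add_le _ _).trans ?_
        rw [norm_mul _ (Complex.exp ζ), norm_neg, Complex.norm_exp ζ, norm_div, Complex.norm_real,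
          Real.norm_eq_abs, abs_of_pos hp]
        gcongr
        rw [div_le_iff₀ hp]; linarith
    _ ≤ _ := by nlinarith

lemma Strip.DD1 (h : Strip Δ β ζ) (hp : 0 < Δ) :
    ‖Dz (2 - Δ) β ζ - D1z Δ β ζ‖ ≤ 300 * Δ * (Real.exp (3 / 2 * ζ.re) + Real.exp (3 * ζ.re)) := by
  have hne : (Δ : ℂ) ≠ 0 := by exact_mod_cast hp.ne'
  have e : Dz (2 - Δ) β ζ - D1z Δ β ζ =
      (Complex.exp (2 * ζ) - Complex.exp ((2 - Δ : ℝ) * ζ) - Δ * (ζ * Complex.exp ((2 - Δ : ℝ) * ζ))) / Δ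
      - Complex.I * β * ((_root_.tauD (2 - Δ) + tauP (2 - Δ) / Δ : ℝ) : ℂ) * Complex.exp ((2 - Δ : ℝ) * ζ)
      - Complex.I * β * tauP (2 - Δ) * (ζ * Complex.exp ((2 - Δ : ℝ) * ζ)) := by
    unfold Dz D1z Ez Lz
    simp only [Complex.ofReal_add, Complex.ofReal_div]
    field_simp
    ring
  rw [e]
  have h1 := h.diff2
  have h2 := h.tau
  have hq := h.q hp
  have hz := h.zl
  have ha := h.za
  have p2 := Real.exp_pos (3 / 2 * ζ.re)
  have p3 := Real.exp_pos (3 * ζ.re)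
  set S := Real.exp (3 / 2 * ζ.re) + Real.exp (3 * ζ.re) with hS
  have hSp : 0 < S := by positivity
  calc _ ≤ 128 * Δ * S + 10 * Δ * S + 2 * Δ * (64 * S) := by
        refine (norm_sub_le _ _).trans ?_
        rw [norm_mul (Complex.I * (β:ℂ) * (tauP (2 - Δ) : ℂ))]
        gcongr
        refine (norm_sub_le _ _).trans ?_
        rw [norm_mul _ (Complex.exp _), norm_div, Complex.norm_real,
          Real.norm_eq_abs, abs_of_pos hp]
        gcongr
        rw [div_le_iff₀ hp]; nlinarith
    _ ≤ _ := by nlinarith [mul_pos hp hSp]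

end Part1

section Part2

/-! ### Contour rotation -/

lemma image_exp_univ' : Real.exp '' univ = Ioi (0:ℝ) := by
  rw [image_univ, Real.range_exp]

lemma chvar (F : ℝ → ℂ) : ∫ t in Ioi (0:ℝ), F t = ∫ u : ℝ, (Real.exp u : ℂ) * F (Real.exp u) := by
  rw [← image_exp_univ', integral_image_eq_integral_abs_deriv_smul MeasurableSet.univ
    (fun x _ => (Real.hasDerivAt_exp x).hasDerivWithinAt) (Real.exp_injective.injOn)]
  simp [abs_of_pos (Real.exp_pos _)]

lemma chvar_int (F : ℝ → ℝ) : IntegrableOn F (Ioi (0:ℝ)) ↔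
    Integrable (fun u => Real.exp u * F (Real.exp u)) := by
  rw [← image_exp_univ', integrableOn_image_iff_integrableOn_abs_deriv_smul MeasurableSet.univ
    (fun x _ => (Real.hasDerivAt_exp x).hasDerivWithinAt) (Real.exp_injective.injOn)]
  simp [abs_of_pos (Real.exp_pos _)]

lemma intOn_pow_exp {p k : ℝ} (hp : -1 < p) (hk : 0 < k) :
    IntegrableOn (fun s : ℝ => s ^ p * Real.exp (-k * s)) (Ioi 0) := by
  have := integrableOn_rpow_mul_exp_neg_mul_rpow (p := 1) (s := p) (b := k) hp one_pos hk
  simpa using this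

lemma int_pow_exp {p k : ℝ} (hp : -1 < p) (hk : 0 < k) :
    ∫ s in Ioi (0:ℝ), s ^ p * Real.exp (-k * s) = (1 / k) ^ (p + 1) * Real.Gamma (p + 1) := by
  have := Real.integral_rpow_mul_exp_neg_mul_Ioi (a := p + 1) (r := k) (by linarith) hk
  simpa using this

lemma intb {p k : ℝ} (hp : 0 < p) (hk : 0 < k) :
    Integrable (fun u : ℝ => Real.exp (p * u) * Real.exp (-k * Real.exp u)) := by
  have := (chvar_int _).1 (intOn_pow_exp (p := p - 1) (k := k) (by linarith) hk)
  refine this.congr (Eventually.of_forall fun u => ?_)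
  simp only
  rw [← Real.exp_mul, ← mul_assoc, ← Real.exp_add]; ring_nf

lemma tend_top {p k : ℝ} (hk : 0 < k) :
    Tendsto (fun u : ℝ => Real.exp (p * u) * Real.exp (-k * Real.exp u)) atTop (𝓝 0) := by
  have := (tendsto_rpow_mul_exp_neg_mul_atTop_nhds_zero p k hk).comp Real.tendsto_exp_atTop
  refine this.congr fun u => ?_
  simp only [Function.comp]
  rw [← Real.exp_mul, mul_comm u p]

lemma tend_bot {p k : ℝ} (hp : 0 < p) (hk : 0 < k) :
    Tendsto (fun u : ℝ => Real.exp (p * u) * Real.exp (-k * Real.exp u)) atBot (𝓝 0) := by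
  have h1 : Tendsto (fun u : ℝ => Real.exp (p * u)) atBot (𝓝 0) :=
    Real.tendsto_exp_atBot.comp (tendsto_id.const_mul_atBot hp)
  refine squeeze_zero (fun u => by positivity) (fun u => ?_) h1
  have : Real.exp (-k * Real.exp u) ≤ 1 := by
    rw [Real.exp_le_one_iff]; nlinarith [Real.exp_pos u]
  nlinarith [Real.exp_pos (p * u)]

lemma line_shift {G : ℂ → ℂ} (hG : Differentiable ℂ G) {c d : ℝ} (hcd : c ≤ d) {C p k : ℝ}
    (hp : 0 < p) (hk : 0 < k)
    (hb : ∀ u θ : ℝ, c ≤ θ → θ ≤ d →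
      ‖G (u + θ * Complex.I)‖ ≤ C * (Real.exp (p * u) * Real.exp (-k * Real.exp u))) :
    ∫ u : ℝ, G (u + c * Complex.I) = ∫ u : ℝ, G (u + d * Complex.I) := by
  have hInt : ∀ θ, c ≤ θ → θ ≤ d → Integrable (fun u : ℝ => G (u + θ * Complex.I)) := by
    intro θ h1 h2
    refine ((intb hp hk).const_mul C).mono' ?_ (Eventually.of_forall fun u => hb u θ h1 h2)
    exact (hG.continuous.comp (by fun_prop)).aestronglyMeasurable
  have t1 := intervalIntegral_tendsto_integral (hInt c le_rfl hcd) tendsto_neg_atTop_atBot tendsto_id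
  have t2 := intervalIntegral_tendsto_integral (hInt d hcd le_rfl) tendsto_neg_atTop_atBot tendsto_id
  have hvert : ∀ u : ℝ, ‖∫ y : ℝ in c..d, G (u + y * Complex.I)‖ ≤
      (C * (Real.exp (p * u) * Real.exp (-k * Real.exp u))) * |d - c| := by
    intro u
    refine intervalIntegral.norm_integral_le_of_norm_le_const fun y hy => ?_
    rw [uIoc_of_le hcd] at hy
    exact hb u y hy.1.le hy.2
  have v1 : Tendsto (fun T : ℝ => ∫ y : ℝ in c..d, G (T + y * Complex.I)) atTop (𝓝 0) := by
    rw [tendsto_zero_iff_norm_tendsto_zero]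
    refine squeeze_zero (fun _ => norm_nonneg _) (fun T => hvert T) ?_
    simpa using ((tend_top (p := p) hk).const_mul C).mul_const |d - c|
  have v2 : Tendsto (fun T : ℝ => ∫ y : ℝ in c..d, G ((-T : ℝ) + y * Complex.I)) atTop (𝓝 0) := by
    rw [tendsto_zero_iff_norm_tendsto_zero]
    refine squeeze_zero (fun _ => norm_nonneg _) (fun T => hvert (-T)) ?_
    simpa using (((tend_bot hp hk).comp tendsto_neg_atTop_atBot).const_mul C).mul_const |d - c|
  have key : ∀ T : ℝ, (∫ u in (-T)..T, G (u + c * Complex.I)) - (∫ u in (-T)..T, G (u + d * Complex.I))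
      = Complex.I * (∫ y : ℝ in c..d, G ((-T : ℝ) + y * Complex.I))
        - Complex.I * (∫ y : ℝ in c..d, G (T + y * Complex.I)) := by
    intro T
    have := Complex.integral_boundary_rect_eq_zero_of_differentiableOn G
      (⟨-T, c⟩ : ℂ) (⟨T, d⟩ : ℂ) hG.differentiableOn
    simp only [smul_eq_mul] at this
    linear_combination this
  have t3 := t1.sub t2
  have t4 := (v2.const_mul Complex.I).sub (v1.const_mul Complex.I)
  simp only [mul_zero, sub_zero] at t4
  have := tendsto_nhds_unique (t3.congr (fun T => by simpa using key T)) t4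
  exact sub_eq_zero.1 this

noncomputable def ray (s : ℝ) : ℂ := (Real.log s : ℂ) + ((-(Real.pi / 6) : ℝ) : ℂ) * Complex.I

lemma ray_re (s : ℝ) : (ray s).re = Real.log s := by simp [ray]
lemma ray_im (s : ℝ) : (ray s).im = -(Real.pi / 6) := by simp [ray]

noncomputable def rayInt (x : ℝ) (Ψ : ℂ → ℂ) : ℂ :=
  ∫ s in Ioi (0:ℝ), (s : ℂ)⁻¹ *
    (Complex.exp (-(Complex.I * Complex.exp (ray s) * x)) * Ψ (ray s) * Complex.exp (ray s))

lemma norm_osc (x : ℝ) (ζ : ℂ) : ‖Complex.exp (-(Complex.I * Complex.exp ζ * x))‖ =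
    Real.exp (x * (Real.exp ζ.re * Real.sin ζ.im)) := by
  rw [Complex.norm_exp]
  congr 1
  simp [Complex.exp_re, Complex.exp_im]
  ring

lemma rayInt_eq (x : ℝ) (Ψ : ℂ → ℂ) : rayInt x Ψ = ∫ u : ℝ,
    (fun ζ : ℂ => Complex.exp (-(Complex.I * Complex.exp ζ * x)) * Ψ ζ * Complex.exp ζ)
      (u + ((-(Real.pi / 6) : ℝ) : ℂ) * Complex.I) := by
  unfold rayInt
  rw [chvar]
  congr 1; ext u
  have : (Real.exp u : ℂ) ≠ 0 := by exact_mod_cast (Real.exp_pos u).ne'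
  rw [mul_inv_cancel_left₀ this]
  simp [ray]

lemma rot {Φ : ℂ → ℂ} (hd : Differentiable ℂ Φ) {C : ℝ}
    (hΦ : ∀ ζ : ℂ, -(Real.pi / 6) ≤ ζ.im → ζ.im ≤ 0 → ‖Φ ζ‖ ≤ C * Real.exp (-(1/16) * Real.exp ζ.re))
    {x : ℝ} (hx : 0 ≤ x) :
    ∫ t in Ioi (0:ℝ), Complex.exp (-(Complex.I * (t : ℂ) * x)) * Φ (Real.log t) = rayInt x Φ := by
  rw [rayInt_eq, chvar]
  have := line_shift (G := fun ζ : ℂ => Complex.exp (-(Complex.I * Complex.exp ζ * x)) * Φ ζ * Complex.exp ζ)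
    (c := -(Real.pi / 6)) (d := 0) (by fun_prop) (by linarith [Real.pi_pos]) (C := C) (p := 1) (k := 1/16)
    one_pos (by norm_num) ?_
  · rw [this]
    congr 1; ext u
    simp
    ring
  · intro u θ h1 h2
    have := hΦ (u + θ * Complex.I) (by simpa using h1) (by simpa using h2)
    simp only [norm_mul, norm_osc]
    rw [Complex.norm_exp]
    simp only [Complex.add_re, Complex.ofReal_re, Complex.mul_re, Complex.I_re, Complex.ofReal_im,
      Complex.I_im, Complex.add_im, Complex.mul_im, mul_zero, mul_one, zero_mul, add_zero, sub_zero, zero_add] at this ⊢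
    have h3 : Real.sin θ ≤ 0 := Real.sin_nonpos_of_nonpos_of_neg_pi_le h2 (by linarith [Real.pi_pos])
    have h4 : Real.exp (x * (Real.exp u * Real.sin θ)) ≤ 1 := by
      rw [Real.exp_le_one_iff]
      exact mul_nonpos_of_nonneg_of_nonpos hx (mul_nonpos_of_nonneg_of_nonpos (Real.exp_pos u).le h3)
    rw [one_mul]
    have h5 : 0 ≤ C * Real.exp (-(1/16) * Real.exp u) := (norm_nonneg _).trans this
    calc _ ≤ 1 * (C * Real.exp (-(1/16) * Real.exp u)) * Real.exp u := by gcongr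
      _ = _ := by ring

lemma ray_term_norm {x : ℝ} {Ψ : ℂ → ℂ} {s : ℝ} (hs : 0 < s) :
    ‖(s : ℂ)⁻¹ *
    (Complex.exp (-(Complex.I * Complex.exp (ray s) * x)) * Ψ (ray s) * Complex.exp (ray s))‖ =
    Real.exp (-(x / 2) * s) * ‖Ψ (ray s)‖ := by
  simp only [norm_mul, norm_osc, norm_inv, Complex.norm_real, Real.norm_eq_abs, abs_of_pos hs,
    Complex.norm_exp (ray s), ray_re, ray_im, Real.exp_log hs, Real.sin_neg, Real.sin_pi_div_six]
  field_simp

lemma ray_int {x : ℝ} {Ψ : ℂ → ℂ} (hΨ : Continuous Ψ) {B : ℝ → ℝ}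
    (hB : IntegrableOn (fun s => Real.exp (-(x / 2) * s) * B s) (Ioi 0))
    (hb : ∀ s, 0 < s → ‖Ψ (ray s)‖ ≤ B s) :
    IntegrableOn (fun s : ℝ => (s : ℂ)⁻¹ *
    (Complex.exp (-(Complex.I * Complex.exp (ray s) * x)) * Ψ (ray s) * Complex.exp (ray s))) (Ioi 0) := by
  have hray : Measurable ray := by unfold ray; fun_prop
  refine hB.mono' ?_ ?_
  · refine Measurable.aestronglyMeasurable ?_
    have := hΨ.measurable
    fun_prop
  · filter_upwards [ae_restrict_mem measurableSet_Ioi] with s hs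
    rw [ray_term_norm hs]
    gcongr
    exact hb s hs

lemma ray_bound {x : ℝ} {Ψ : ℂ → ℂ} {B : ℝ → ℝ}
    (hB : IntegrableOn (fun s => Real.exp (-(x / 2) * s) * B s) (Ioi 0))
    (hb : ∀ s, 0 < s → ‖Ψ (ray s)‖ ≤ B s) :
    ‖rayInt x Ψ‖ ≤ ∫ s in Ioi (0:ℝ), Real.exp (-(x / 2) * s) * B s := by
  unfold rayInt
  refine norm_integral_le_of_norm_le hB ?_
  filter_upwards [ae_restrict_mem measurableSet_Ioi] with s hs
  rw [ray_term_norm hs]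
  gcongr
  exact hb s hs

/-- Standard comparison functions. -/
noncomputable def Bf (A₁ p A₂ q : ℝ) (s : ℝ) : ℝ := A₁ * (s ^ p + s ^ (7:ℝ)) + A₂ * (s ^ q + s ^ (7:ℝ))

lemma Bf_int {x : ℝ} (hx : 0 < x) {A₁ p A₂ q : ℝ} (hp : 0 ≤ p) (hq : 0 ≤ q) :
    IntegrableOn (fun s => Real.exp (-(x / 2) * s) * Bf A₁ p A₂ q s) (Ioi 0) := by
  have hk : 0 < x / 2 := by positivity
  have h1 := intOn_pow_exp (p := p) (k := x / 2) (by linarith) hk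
  have h2 := intOn_pow_exp (p := q) (k := x / 2) (by linarith) hk
  have h3 := intOn_pow_exp (p := 7) (k := x / 2) (by linarith) hk
  have h4 : IntegrableOn (fun s => A₁ * (s ^ p * Real.exp (-(x / 2) * s) + s ^ (7:ℝ) * Real.exp (-(x / 2) * s)) +
      A₂ * (s ^ q * Real.exp (-(x / 2) * s) + s ^ (7:ℝ) * Real.exp (-(x / 2) * s))) (Ioi 0) :=
    ((h1.add h3).const_mul A₁).add ((h2.add h3).const_mul A₂)
  refine h4.congr_fun ?_ measurableSet_Ioi
  intro s _
  simp only [Bf]; ring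

lemma Bf_val {x : ℝ} (hx : 0 < x) {A₁ p A₂ q : ℝ} (hp : 0 ≤ p) (hq : 0 ≤ q) :
    ∫ s in Ioi (0:ℝ), Real.exp (-(x / 2) * s) * Bf A₁ p A₂ q s =
      A₁ * ((1 / (x / 2)) ^ (p + 1) * Real.Gamma (p + 1) + (1 / (x / 2)) ^ ((7:ℝ) + 1) * Real.Gamma (7 + 1)) +
      A₂ * ((1 / (x / 2)) ^ (q + 1) * Real.Gamma (q + 1) + (1 / (x / 2)) ^ ((7:ℝ) + 1) * Real.Gamma (7 + 1)) := by
  have hk : 0 < x / 2 := by positivity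
  have h1 := intOn_pow_exp (p := p) (k := x / 2) (by linarith) hk
  have h2 := intOn_pow_exp (p := q) (k := x / 2) (by linarith) hk
  have h3 := intOn_pow_exp (p := 7) (k := x / 2) (by linarith) hk
  have h4 : IntegrableOn (fun s => A₁ * (s ^ p * Real.exp (-(x / 2) * s) + s ^ (7:ℝ) * Real.exp (-(x / 2) * s))) (Ioi 0) :=
    (h1.add h3).const_mul A₁
  have h5 : IntegrableOn (fun s => A₂ * (s ^ q * Real.exp (-(x / 2) * s) + s ^ (7:ℝ) * Real.exp (-(x / 2) * s))) (Ioi 0) :=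
    (h2.add h3).const_mul A₂
  rw [← int_pow_exp (by linarith) hk, ← int_pow_exp (by linarith) hk, ← int_pow_exp (by linarith) hk,
    ← integral_add h1 h3, ← integral_add h2 h3, ← integral_const_mul, ← integral_const_mul,
    ← integral_add h4 h5]
  refine setIntegral_congr_fun measurableSet_Ioi fun s _ => ?_
  simp only [Bf]; ring

lemma Bf_bound (p q : ℝ) (hp : 0 ≤ p) (hq : 0 ≤ q) (hp7 : p ≤ 7) (hq7 : q ≤ 7) :
    ∃ K : ℝ, 0 ≤ K ∧ ∀ A₁ A₂ x : ℝ, 0 ≤ A₁ → 0 ≤ A₂ → 1 ≤ x →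
      ∫ s in Ioi (0:ℝ), Real.exp (-(x / 2) * s) * Bf A₁ p A₂ q s ≤
        K * (A₁ * x ^ (-(p + 1)) + A₂ * x ^ (-(q + 1))) := by
  have main : ∀ r : ℝ, 0 ≤ r → r ≤ 7 → ∀ x : ℝ, 1 ≤ x →
      (1 / (x / 2)) ^ (r + 1) * Real.Gamma (r + 1) + (1 / (x / 2)) ^ ((7:ℝ) + 1) * Real.Gamma (7 + 1) ≤
       (2 ^ (r + 1) * Real.Gamma (r + 1) + 2 ^ ((7:ℝ) + 1) * Real.Gamma (7 + 1)) * x ^ (-(r + 1)) := by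
    intro r hr hr7 x hx
    have hx0 : 0 < x := by linarith
    have e : ∀ t : ℝ, (1 / (x / 2)) ^ t = 2 ^ t * x ^ (-t) := by
      intro t
      rw [show 1 / (x / 2) = 2 * x⁻¹ by field_simp, Real.mul_rpow (by norm_num) (by positivity),
        Real.inv_rpow hx0.le, Real.rpow_neg hx0.le]
    rw [e, e]
    have : x ^ (-((7:ℝ) + 1)) ≤ x ^ (-(r + 1)) := by
      apply Real.rpow_le_rpow_of_exponent_le hx; linarith
    have g7 : 0 < Real.Gamma (7 + 1) := Real.Gamma_pos_of_pos (by norm_num)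
    have : 2 ^ ((7:ℝ) + 1) * x ^ (-((7:ℝ) + 1)) * Real.Gamma (7 + 1) ≤
      2 ^ ((7:ℝ) + 1) * x ^ (-(r + 1)) * Real.Gamma (7 + 1) := by gcongr
    linarith
  have gp := Real.Gamma_pos_of_pos (show 0 < p + 1 by linarith)
  have gq := Real.Gamma_pos_of_pos (show 0 < q + 1 by linarith)
  have g7 : 0 < Real.Gamma (7 + 1) := Real.Gamma_pos_of_pos (by norm_num)
  set K₁ := (2 ^ (p + 1) * Real.Gamma (p + 1) + 2 ^ ((7:ℝ) + 1) * Real.Gamma (7 + 1)) with hK1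
  set K₂ := (2 ^ (q + 1) * Real.Gamma (q + 1) + 2 ^ ((7:ℝ) + 1) * Real.Gamma (7 + 1)) with hK2
  have k1 : 0 ≤ K₁ := by positivity
  have k2 : 0 ≤ K₂ := by positivity
  refine ⟨K₁ + K₂, by positivity, ?_⟩
  intro A₁ A₂ x h1 h2 hx
  have hx0 : 0 < x := by linarith
  rw [Bf_val hx0 hp hq]
  have m1 := main p hp hp7 x hx
  have m2 := main q hq hq7 x hx
  have p1 : 0 ≤ x ^ (-(p + 1)) := by positivity
  have p2 : 0 ≤ x ^ (-(q + 1)) := by positivity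
  calc _ ≤ A₁ * (K₁ * x ^ (-(p + 1))) + A₂ * (K₂ * x ^ (-(q + 1))) := by gcongr
    _ ≤ _ := by nlinarith [mul_nonneg (mul_nonneg k2 h1) p1, mul_nonneg (mul_nonneg k1 h2) p2]

lemma rayInt_add {x : ℝ} (hx : 0 < x) {Ψ₁ Ψ₂ : ℂ → ℂ} (h1 : Continuous Ψ₁) (h2 : Continuous Ψ₂)
    {A₁ p A₂ q A₃ p' A₄ q' : ℝ} (hp : 0 ≤ p) (hq : 0 ≤ q) (hp' : 0 ≤ p') (hq' : 0 ≤ q')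
    (hb : ∀ s, 0 < s → ‖Ψ₁ (ray s)‖ ≤ Bf A₁ p A₂ q s)
    (hb' : ∀ s, 0 < s → ‖Ψ₂ (ray s)‖ ≤ Bf A₃ p' A₄ q' s) :
    rayInt x (fun ζ => Ψ₁ ζ + Ψ₂ ζ) = rayInt x Ψ₁ + rayInt x Ψ₂ := by
  unfold rayInt
  rw [← integral_add (ray_int h1 (Bf_int hx hp hq) hb) (ray_int h2 (Bf_int hx hp' hq') hb')]
  congr 1; ext s; ring

lemma rayInt_const_mul (x : ℝ) (c : ℂ) (Ψ : ℂ → ℂ) :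
    rayInt x (fun ζ => c * Ψ ζ) = c * rayInt x Ψ := by
  unfold rayInt
  rw [← integral_const_mul]
  congr 1; ext s; ring

/-- Exact power integrals along the ray. -/
lemma rayInt_pow {x : ℝ} (hx : 0 < x) {a : ℝ} (ha : 0 < a) :
    rayInt x (fun ζ => Complex.exp (((a - 1 : ℝ) : ℂ) * ζ)) =
      ((x ^ (-a) * Real.Gamma a : ℝ) : ℂ) * Complex.exp (-(Real.pi * a / 2 : ℝ) * Complex.I) := by
  rw [rayInt_eq]
  have := line_shift (G := fun ζ : ℂ => Complex.exp (-(Complex.I * Complex.exp ζ * x)) *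
      Complex.exp (((a - 1 : ℝ) : ℂ) * ζ) * Complex.exp ζ)
    (c := -(Real.pi / 2)) (d := -(Real.pi / 6)) (by fun_prop) (by linarith [Real.pi_pos])
    (C := 1) (p := a) (k := x / 2) ha (by positivity) ?_
  · rw [← this]
    have e := int_pow_exp (p := a - 1) (k := x) (by linarith) hx
    have e2 : ∫ s in Ioi (0:ℝ), ((s ^ (a - 1) * Real.exp (-x * s) : ℝ) : ℂ) =
        (((1 / x) ^ (a - 1 + 1) * Real.Gamma (a - 1 + 1) : ℝ) : ℂ) := by
      rw [← e]; exact integral_ofReal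
    rw [sub_add_cancel, one_div, Real.inv_rpow hx.le, ← Real.rpow_neg hx.le] at e2
    rw [← e2, chvar, ← integral_mul_const]
    congr 1; ext u
    rw [← Real.exp_mul]
    push_cast
    have hI : Complex.exp ((u : ℂ) + -((Real.pi : ℂ) / 2) * Complex.I) = -Complex.I * Complex.exp u := by
      rw [Complex.exp_add, show -((Real.pi : ℂ) / 2) * Complex.I = (-Real.pi / 2) * Complex.I by ring,
        Complex.exp_neg_pi_div_two_mul_I]; ring
    rw [hI, show -(Complex.I * (-Complex.I * Complex.exp u) * x) = -x * Complex.exp u by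
      linear_combination (x * Complex.exp u) * Complex.I_mul_I]
    rw [← hI]
    simp only [← Complex.exp_add]
    congr 1; ring
  · intro u θ h1 h2
    simp only [norm_mul, norm_osc, norm_exp_mul, Complex.norm_exp ((u:ℂ) + θ * Complex.I)]
    simp only [Complex.add_re, Complex.ofReal_re, Complex.mul_re, Complex.I_re, Complex.ofReal_im,
      Complex.I_im, Complex.add_im, Complex.mul_im, mul_zero, mul_one, zero_mul, add_zero, sub_zero, zero_add]
    have h3 : Real.sin θ ≤ -(1/2) := by
      have : Real.sin (-(Real.pi / 6)) = -(1/2) := by rw [Real.sin_neg, Real.sin_pi_div_six]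
      rw [← this]
      apply Real.sin_le_sin_of_le_of_le_pi_div_two <;> linarith [Real.pi_pos]
    rw [mul_assoc, ← Real.exp_add, one_mul, mul_comm]
    gcongr ?_ * ?_
    · apply Real.exp_le_exp.2; linarith
    · apply Real.exp_le_exp.2
      nlinarith [mul_pos hx (Real.exp_pos u)]

end Part2

section Part3

/-! ### Integrals along the real axis -/

/-- Exponential decay in the strip. -/
def Dec (C : ℝ) (Φ : ℂ → ℂ) : Prop := ∀ ζ : ℂ, -(Real.pi / 6) ≤ ζ.im → ζ.im ≤ 0 →
  ‖Φ ζ‖ ≤ C * Real.exp (-(1/16) * Real.exp ζ.re)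

noncomputable def axInt (x : ℝ) (Φ : ℂ → ℂ) : ℂ :=
  ∫ t in Ioi (0:ℝ), Complex.exp (-(Complex.I * (t : ℂ) * x)) * Φ (Real.log t)

lemma Dec.real {C : ℝ} {Φ : ℂ → ℂ} (h : Dec C Φ) {t : ℝ} (ht : 0 < t) :
    ‖Φ (Real.log t)‖ ≤ C * Real.exp (-(1/16) * t) := by
  have := h (Real.log t) (by simp; positivity) (by simp)
  simpa [Real.exp_log ht] using this

lemma norm_osc_real (x t : ℝ) : ‖Complex.exp (-(Complex.I * (t : ℂ) * x))‖ = 1 := by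
  rw [Complex.norm_exp]; simp

lemma int_exp16 : IntegrableOn (fun t : ℝ => Real.exp (-(1/16) * t)) (Ioi 0) := by
  have := intOn_pow_exp (p := 0) (k := 1/16) (by norm_num) (by norm_num)
  simpa using this

lemma val_exp16 : ∫ t in Ioi (0:ℝ), Real.exp (-(1/16) * t) = 16 := by
  have := int_pow_exp (p := 0) (k := 1/16) (by norm_num) (by norm_num)
  simp at this
  convert this using 3
  norm_num

lemma ax_meas {Φ : ℂ → ℂ} (hc : Continuous Φ) (x : ℝ) :
    Measurable (fun t : ℝ => Complex.exp (-(Complex.I * (t : ℂ) * x)) * Φ (Real.log t)) := by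
  have := hc.measurable
  fun_prop

lemma ax_int {C : ℝ} {Φ : ℂ → ℂ} (hc : Continuous Φ) (h : Dec C Φ) (x : ℝ) :
    IntegrableOn (fun t : ℝ => Complex.exp (-(Complex.I * (t : ℂ) * x)) * Φ (Real.log t)) (Ioi 0) := by
  refine (int_exp16.const_mul C).mono' (ax_meas hc x).aestronglyMeasurable ?_
  filter_upwards [ae_restrict_mem measurableSet_Ioi] with t ht
  rw [norm_mul, norm_osc_real, one_mul]
  exact h.real ht

lemma ax_bound {C : ℝ} {Φ : ℂ → ℂ} (h : Dec C Φ) (x : ℝ) : ‖axInt x Φ‖ ≤ 16 * C := by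
  have : ∫ t in Ioi (0:ℝ), C * Real.exp (-(1/16) * t) = 16 * C := by
    rw [integral_const_mul, val_exp16, mul_comm]
  rw [← this]
  refine norm_integral_le_of_norm_le (int_exp16.const_mul C) ?_
  filter_upwards [ae_restrict_mem measurableSet_Ioi] with t ht
  rw [norm_mul, norm_osc_real, one_mul]
  exact h.real ht

lemma ax_cont {C : ℝ} {Φ : ℂ → ℂ} (hc : Continuous Φ) (h : Dec C Φ) : Continuous (fun x => axInt x Φ) := by
  refine continuous_of_dominated (bound := fun t => C * Real.exp (-(1/16) * t))
    (fun x => (ax_meas hc x).aestronglyMeasurable) ?_ (int_exp16.const_mul C) ?_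
  · intro x
    filter_upwards [ae_restrict_mem measurableSet_Ioi] with t ht
    rw [norm_mul, norm_osc_real, one_mul]
    exact h.real ht
  · refine Eventually.of_forall fun t => ?_
    fun_prop

lemma ax_sub {C C' : ℝ} {Φ Φ' : ℂ → ℂ} (hc : Continuous Φ) (h : Dec C Φ) (hc' : Continuous Φ') (h' : Dec C' Φ')
    (x : ℝ) : axInt x (fun ζ => Φ ζ - Φ' ζ) = axInt x Φ - axInt x Φ' := by
  unfold axInt
  rw [← integral_sub (ax_int hc h x) (ax_int hc' h' x)]
  congr 1; ext t; ring

lemma ax_deriv {C C' : ℝ} {Φ : ℂ → ℂ} (hc : Continuous Φ) (h : Dec C Φ)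
    (h' : Dec C' (fun ζ => -Complex.I * Complex.exp ζ * Φ ζ)) (x : ℝ) :
    HasDerivAt (fun x => axInt x Φ) (axInt x (fun ζ => -Complex.I * Complex.exp ζ * Φ ζ)) x := by
  have hc' : Continuous (fun ζ => -Complex.I * Complex.exp ζ * Φ ζ) := by fun_prop
  refine (hasDerivAt_integral_of_dominated_loc_of_deriv_le (s := univ)
    (F' := fun x t => Complex.exp (-(Complex.I * (t : ℂ) * x)) *
      (-Complex.I * Complex.exp (Real.log t) * Φ (Real.log t)))
    (bound := fun t => C' * Real.exp (-(1/16) * t)) univ_mem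
    (Eventually.of_forall fun x => (ax_meas hc x).aestronglyMeasurable) (ax_int hc h x)
    (ax_meas hc' x).aestronglyMeasurable ?_ (int_exp16.const_mul C') ?_).2
  · filter_upwards [ae_restrict_mem measurableSet_Ioi] with t ht x _
    rw [norm_mul, norm_osc_real, one_mul]
    exact h'.real ht
  · filter_upwards [ae_restrict_mem measurableSet_Ioi] with t ht x _
    have e : Complex.exp ((Real.log t : ℝ) : ℂ) = t := by
      rw [← Complex.ofReal_exp, Real.exp_log ht]
    rw [e]
    have h1 : HasDerivAt (fun y : ℝ => -(Complex.I * (t : ℂ) * y)) (-(Complex.I * t * 1)) x :=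
      ((Complex.ofRealCLM.hasDerivAt).const_mul (Complex.I * (t : ℂ))).neg
    have := (h1.cexp).mul_const (Φ (Real.log t))
    refine this.congr_deriv ?_
    ring

/-! ### The stable density -/

lemma stable_eq (a β x : ℝ) :
    stableDensity a β x = (1 / Real.pi) * (axInt x (fun ζ => Complex.exp (Lz a β ζ))).re := by
  unfold stableDensity axInt
  congr 2
  refine setIntegral_congr_fun measurableSet_Ioi fun t ht => ?_
  simp only
  congr 2
  have ht0 : (0:ℝ) < t := ht
  have e1 : Complex.exp (a * (Real.log t : ℝ)) = ((t ^ a : ℝ) : ℂ) := by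
    rw [Real.rpow_def_of_pos ht0]; push_cast; congr 1; ring
  have e2 : Complex.exp ((Real.log t : ℝ)) = t := by
    rw [← Complex.ofReal_exp, Real.exp_log ht0]
  have e3 : ((t ^ a : ℝ) : ℂ) * ((t ^ (1 - a) : ℝ) : ℂ) = t := by
    rw [← Complex.ofReal_mul, ← Real.rpow_add ht0]; simp
  unfold Lz tauP
  rw [e1, e2]
  push_cast
  linear_combination (-Complex.I * β * Complex.tan (Real.pi * a / 2)) * e3

lemma pow_le16 (n : ℕ) {s : ℝ} (hs : 0 ≤ s) : s ^ n ≤ n.factorial * 16 ^ n * Real.exp (s / 16) := by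
  have := Real.pow_div_factorial_le_exp (s / 16) (by positivity) n
  rw [div_pow, div_div, div_le_iff₀ (by positivity)] at this
  linarith

lemma dec_poly {s : ℝ} (hs : 0 ≤ s) :
    Real.exp (2 - s / 8) * (1 + s + s ^ 2 + s ^ 3 + s ^ 4) ≤ 10 ^ 8 * Real.exp (-(1/16) * s) := by
  have h0 : 1 ≤ Real.exp (s / 16) := Real.one_le_exp (by positivity)
  have h1 := pow_le16 1 hs
  have h2 := pow_le16 2 hs
  have h3 := pow_le16 3 hs
  have h4 := pow_le16 4 hs
  norm_num [Nat.factorial] at h1 h2 h3 h4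
  have h5 : 1 + s + s ^ 2 + s ^ 3 + s ^ 4 ≤ 2000000 * Real.exp (s / 16) := by linarith
  have e : Real.exp (2 - s / 8) = Real.exp 2 * Real.exp (-(s / 8)) := by rw [← Real.exp_add]; ring_nf
  have e2 : Real.exp (-(s / 8)) * Real.exp (s / 16) = Real.exp (-(1/16) * s) := by
    rw [← Real.exp_add]; ring_nf
  calc _ ≤ (8 * Real.exp (-(s / 8))) * (2000000 * Real.exp (s / 16)) := by
        rw [e]
        have := exp_two_lt
        gcongr
    _ = 16000000 * Real.exp (-(1/16) * s) := by rw [← e2]; ring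
    _ ≤ _ := by gcongr; norm_num

lemma dec_of {C : ℝ} (hC : 0 ≤ C) {Φ : ℂ → ℂ} (h : ∀ ζ : ℂ, -(Real.pi / 6) ≤ ζ.im → ζ.im ≤ 0 →
    ‖Φ ζ‖ ≤ C * (Real.exp (2 - Real.exp ζ.re / 8) * (1 + Real.exp ζ.re + Real.exp ζ.re ^ 2 +
      Real.exp ζ.re ^ 3 + Real.exp ζ.re ^ 4))) : Dec (C * 10 ^ 8) Φ := by
  intro ζ h1 h2
  refine (h ζ h1 h2).trans ?_
  rw [mul_assoc]
  exact mul_le_mul_of_nonneg_left (dec_poly (Real.exp_pos _).le) hC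

lemma exp3 (r : ℝ) : Real.exp (3 * r) = Real.exp r ^ 3 := by
  rw [← Real.exp_nat_mul]; norm_num

structure Par (Δ β : ℝ) : Prop where
  h0 : 0 ≤ Δ
  h1 : Δ ≤ 1 / 100
  hb : |β| ≤ 1

lemma Par.strip {Δ β : ℝ} (h : Par Δ β) {ζ : ℂ} (h1 : -(Real.pi / 6) ≤ ζ.im) (h2 : ζ.im ≤ 0) : Strip Δ β ζ :=
  ⟨h.h0, h.h1, h.hb, h2, h1⟩

noncomputable def stL (Δ β : ℝ) (ζ : ℂ) : ℂ := Complex.exp (Lz (2 - Δ) β ζ)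
noncomputable def gsL (ζ : ℂ) : ℂ := Complex.exp (-Complex.exp (2 * ζ))

lemma Lz_diff (a β : ℝ) : Differentiable ℂ (Lz a β) := by unfold Lz; fun_prop
lemma Dz_diff (a β : ℝ) : Differentiable ℂ (Dz a β) := by unfold Dz; fun_prop
lemma Ez_diff (a β : ℝ) : Differentiable ℂ (Ez a β) := by unfold Ez Lz; fun_prop
lemma D1z_diff (a β : ℝ) : Differentiable ℂ (D1z a β) := by
  unfold D1z; have := Ez_diff (2 - a) β; fun_prop
lemma stL_diff (a β : ℝ) : Differentiable ℂ (stL a β) := by unfold stL; have := Lz_diff (2 - a) β; fun_prop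
lemma gsL_diff : Differentiable ℂ gsL := by unfold gsL; fun_prop

section
variable {Δ β : ℝ}

lemma Par.decGL (h : Par Δ β) : Dec (1 * 10 ^ 8) (stL Δ β) := by
  refine dec_of zero_le_one fun ζ h1 h2 => ?_
  have := (h.strip h1 h2).expL
  have e := Real.exp_pos ζ.re
  refine this.trans ?_
  rw [one_mul]
  exact le_mul_of_one_le_right (Real.exp_pos _).le (by nlinarith [pow_pos e 2, pow_pos e 3, pow_pos e 4])

lemma decGG : Dec (1 * 10 ^ 8) gsL := by
  refine dec_of zero_le_one fun ζ h1 h2 => ?_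
  have hp : Par 0 0 := ⟨le_rfl, by norm_num, by norm_num⟩
  have h3 := (hp.strip h1 h2).z2re
  have e := Real.exp_pos ζ.re
  rw [gsL, Complex.norm_exp]
  refine (Real.exp_le_exp.2 h3).trans ?_
  rw [one_mul]
  exact le_mul_of_one_le_right (Real.exp_pos _).le (by nlinarith [pow_pos e 2, pow_pos e 3, pow_pos e 4])

lemma norm_mIz (ζ w : ℂ) : ‖-Complex.I * Complex.exp ζ * w‖ = Real.exp ζ.re * ‖w‖ := by
  simp [Complex.norm_exp]

lemma Par.decGLx (h : Par Δ β) : Dec (1 * 10 ^ 8) (fun ζ => -Complex.I * Complex.exp ζ * stL Δ β ζ) := by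
  refine dec_of zero_le_one fun ζ h1 h2 => ?_
  have := (h.strip h1 h2).expL
  have e := Real.exp_pos ζ.re
  rw [norm_mIz, one_mul, mul_comm]
  refine mul_le_mul this ?_ e.le (Real.exp_pos _).le
  nlinarith [pow_pos e 2, pow_pos e 3, pow_pos e 4]

lemma decGGx : Dec (1 * 10 ^ 8) (fun ζ => -Complex.I * Complex.exp ζ * gsL ζ) := by
  refine dec_of zero_le_one fun ζ h1 h2 => ?_
  have hp : Par 0 0 := ⟨le_rfl, by norm_num, by norm_num⟩
  have h3 := (hp.strip h1 h2).z2re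
  have e := Real.exp_pos ζ.re
  rw [norm_mIz, one_mul, mul_comm, gsL, Complex.norm_exp]
  refine mul_le_mul (Real.exp_le_exp.2 h3) ?_ e.le (Real.exp_pos _).le
  nlinarith [pow_pos e 2, pow_pos e 3, pow_pos e 4]

lemma Par.decDiff (h : Par Δ β) : Dec ((300 * Δ) * 10 ^ 8) (fun ζ => stL Δ β ζ - gsL ζ) := by
  have h0 := h.h0
  refine dec_of (by positivity) fun ζ h1 h2 => ?_
  have := (h.strip h1 h2).P5
  have e := Real.exp_pos ζ.re
  refine this.trans ?_
  rw [exp3, show ∀ a b c : ℝ, a * (300 * Δ * b) = 300 * Δ * (a * b) from fun a b c => by ring]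
  · refine mul_le_mul_of_nonneg_left (mul_le_mul_of_nonneg_left ?_ (Real.exp_pos _).le) (by positivity)
    nlinarith [pow_pos e 2, pow_pos e 3, pow_pos e 4]
  · exact 0

lemma Par.decD (h : Par Δ β) : Dec (300 * 10 ^ 8) (fun ζ => Dz (2 - Δ) β ζ * stL Δ β ζ) := by
  refine dec_of (by positivity) fun ζ h1 h2 => ?_
  have h3 := (h.strip h1 h2).Dbd
  have h4 := (h.strip h1 h2).expL
  have e := Real.exp_pos ζ.re
  rw [exp3] at h3
  rw [norm_mul]
  calc _ ≤ (300 * (Real.exp ζ.re + Real.exp ζ.re ^ 3)) * (Real.exp (2 - Real.exp ζ.re / 8)) :=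
        mul_le_mul h3 h4 (norm_nonneg _) (by positivity)
    _ = 300 * (Real.exp (2 - Real.exp ζ.re / 8) * (Real.exp ζ.re + Real.exp ζ.re ^ 3)) := by ring
    _ ≤ _ := by
      refine mul_le_mul_of_nonneg_left (mul_le_mul_of_nonneg_left ?_ (Real.exp_pos _).le) (by positivity)
      nlinarith [pow_pos e 2, pow_pos e 3, pow_pos e 4]

lemma f_eq (Δ β x : ℝ) : stableDensity (2 - Δ) β x = (1 / Real.pi) * (axInt x (stL Δ β)).re := stable_eq _ _ _

lemma re_deriv {F : ℝ → ℂ} {F' : ℂ} {x : ℝ} (h : HasDerivAt F F' x) :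
    HasDerivAt (fun y => (1 / Real.pi) * (F y).re) ((1 / Real.pi) * F'.re) x := by
  have := (Complex.reCLM.hasFDerivAt.comp_hasDerivAt x h)
  exact this.const_mul (1 / Real.pi)

lemma Par.fx_deriv (h : Par Δ β) (x : ℝ) : HasDerivAt (stableDensity (2 - Δ) β)
    ((1 / Real.pi) * (axInt x (fun ζ => -Complex.I * Complex.exp ζ * stL Δ β ζ)).re) x := by
  have := re_deriv (ax_deriv (stL_diff Δ β).continuous h.decGL h.decGLx x)
  convert this using 1
  funext y
  exact f_eq Δ β y

lemma Par.fX_eq (h : Par Δ β) (x : ℝ) : fX (2 - Δ) β x =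
    (1 / Real.pi) * (axInt x (fun ζ => -Complex.I * Complex.exp ζ * stL Δ β ζ)).re := (h.fx_deriv x).deriv

lemma tauP_deriv {a : ℝ} (h1 : 2 - 1/100 < a) (h2 : a < 2) : HasDerivAt tauP (tauD a) a := by
  have hc : Real.cos (Real.pi * a / 2) ≠ 0 := by
    have : Real.cos (Real.pi * a / 2) = -Real.cos (Real.pi - Real.pi * a / 2) := by
      rw [Real.cos_pi_sub, neg_neg]
    rw [this]
    have : 0 < Real.cos (Real.pi - Real.pi * a / 2) := by
      apply Real.cos_pos_of_mem_Ioo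
      constructor <;> nlinarith [Real.pi_pos]
    exact (neg_neg_of_pos this).ne
  have h3 : HasDerivAt (fun a : ℝ => Real.pi * a / 2) (Real.pi * 1 / 2) a :=
    ((hasDerivAt_id a).const_mul Real.pi).div_const 2
  have h4 := ((Real.hasDerivAt_tan hc).comp a h3).neg
  refine h4.congr_deriv ?_
  unfold tauD tauP
  rw [one_div, ← Real.inv_one_add_tan_sq hc]
  simp only [inv_inv]
  ring

lemma Lz_deriv {a : ℝ} (h1 : 2 - 1/100 < a) (h2 : a < 2) (β : ℝ) (ζ : ℂ) :
    HasDerivAt (fun b : ℝ => Lz b β ζ) (Dz a β ζ) a := by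
  have t := (tauP_deriv h1 h2).ofReal_comp
  have e : HasDerivAt (fun b : ℝ => Complex.exp ((b:ℂ) * ζ)) (Complex.exp (a * ζ) * (1 * ζ)) a :=
    ((Complex.ofRealCLM.hasDerivAt).mul_const ζ).cexp
  have := e.neg.add ((t.const_mul (Complex.I * β)).mul (e.const_sub (Complex.exp ζ)))
  refine this.congr_deriv ?_
  unfold Dz; ring

lemma falpha_deriv (h : Par Δ β) (h0 : 0 < Δ) (h1 : Δ < 1 / 100) (x : ℝ) :
    HasDerivAt (fun a => stableDensity a β x)
    ((1 / Real.pi) * (axInt x (fun ζ => Dz (2 - Δ) β ζ * stL Δ β ζ)).re) (2 - Δ) := by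
  have key : HasDerivAt (fun a => axInt x (fun ζ => Complex.exp (Lz a β ζ)))
      (axInt x (fun ζ => Dz (2 - Δ) β ζ * stL Δ β ζ)) (2 - Δ) := by
    have hmem : Ioo (2 - 1/100 : ℝ) 2 ∈ 𝓝 (2 - Δ) := Ioo_mem_nhds (by linarith) (by linarith)
    have hpar : ∀ a ∈ Ioo (2 - 1/100 : ℝ) 2, Par (2 - a) β := fun a ha =>
      ⟨by linarith [ha.2], by linarith [ha.1], h.hb⟩
    refine (hasDerivAt_integral_of_dominated_loc_of_deriv_le (s := Ioo (2 - 1/100 : ℝ) 2)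
      (F := fun a t => Complex.exp (-(Complex.I * (t : ℂ) * x)) * Complex.exp (Lz a β (Real.log t)))
      (μ := volume.restrict (Ioi 0))
      (F' := fun a t => Complex.exp (-(Complex.I * (t : ℂ) * x)) *
        (Dz a β (Real.log t) * Complex.exp (Lz a β (Real.log t))))
      (bound := fun t => (300 * 10 ^ 8) * Real.exp (-(1/16) * t)) hmem
      (Eventually.of_forall fun a => ?_) (ax_int (stL_diff Δ β).continuous h.decGL x)
      (ax_meas ((Dz_diff _ β).continuous.mul (stL_diff Δ β).continuous) x).aestronglyMeasurable ?_ (int_exp16.const_mul _) ?_).2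
    · have := (Lz_diff a β).continuous
      exact (ax_meas (by fun_prop : Continuous (fun ζ => Complex.exp (Lz a β ζ))) x).aestronglyMeasurable
    · filter_upwards [ae_restrict_mem measurableSet_Ioi] with t ht a ha
      rw [norm_mul, norm_osc_real, one_mul]
      have := (hpar a ha).decD.real ht
      simpa [stL] using this
    · filter_upwards [ae_restrict_mem measurableSet_Ioi] with t ht a ha
      have := ((Lz_deriv ha.1 ha.2 β (Real.log t)).cexp).const_mul (Complex.exp (-(Complex.I * (t : ℂ) * x)))
      refine this.congr_deriv ?_
      ring
  have := re_deriv key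
  convert this using 1
  funext a
  exact stable_eq a β x

lemma fAlpha_eq (h : Par Δ β) (h0 : 0 < Δ) (h1 : Δ < 1 / 100) (x : ℝ) : fAlpha (2 - Δ) β x =
    (1 / Real.pi) * (axInt x (fun ζ => Dz (2 - Δ) β ζ * stL Δ β ζ)).re := (falpha_deriv h h0 h1 x).deriv

lemma cont_f (h : Par Δ β) : Continuous (stableDensity (2 - Δ) β) := by
  have : stableDensity (2 - Δ) β = fun x => (1 / Real.pi) * (axInt x (stL Δ β)).re := funext (f_eq Δ β)
  rw [this]
  have := ax_cont (stL_diff Δ β).continuous h.decGL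
  fun_prop

lemma cont_fX (h : Par Δ β) : Continuous (fX (2 - Δ) β) := by
  rw [funext h.fX_eq]
  have h2 := (stL_diff Δ β).continuous
  have := ax_cont (by fun_prop) h.decGLx
  fun_prop

lemma cont_fAlpha (h : Par Δ β) (h0 : 0 < Δ) (h1 : Δ < 1 / 100) : Continuous (fAlpha (2 - Δ) β) := by
  rw [funext (fAlpha_eq h h0 h1)]
  have h2 := (stL_diff Δ β).continuous
  have h3 := (Dz_diff (2 - Δ) β).continuous
  have := ax_cont (by fun_prop) h.decD
  fun_prop

/-! ### The Gaussian -/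

lemma g_eq (x : ℝ) : normalDensity x = (1 / Real.pi) * (axInt x gsL).re := by
  set J := axInt x gsL with hJ
  let H : ℝ → ℂ := fun t => Complex.exp (-1 * (t:ℂ) ^ 2 + (-(Complex.I * x)) * t + 0)
  have hb : (-1 : ℂ).re < 0 := by simp
  have hH : Integrable H := integrable_cexp_quadratic' hb _ _
  have h1 : ∫ t : ℝ, H t = (∫ t in Ioi (0:ℝ), H t) + ∫ t in Ioi (0:ℝ), H (-t) := by
    rw [integral_comp_neg_Ioi, neg_zero, add_comm]
    rw [← setIntegral_union (Set.Iic_disjoint_Ioi le_rfl) measurableSet_Ioi hH.integrableOn hH.integrableOn]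
    simp
  have h2 : ∫ t in Ioi (0:ℝ), H t = J := by
    rw [hJ]; unfold axInt gsL
    refine setIntegral_congr_fun measurableSet_Ioi fun t ht => ?_
    have ht0 : (0:ℝ) < t := ht
    have e2 : Complex.exp (2 * (Real.log t : ℝ)) = t ^ 2 := by
      rw [show (2:ℂ) * (Real.log t : ℝ) = (Real.log t : ℝ) + (Real.log t : ℝ) by ring, Complex.exp_add,
        ← Complex.ofReal_exp, Real.exp_log ht0]; ring
    simp only [H]
    rw [e2, ← Complex.exp_add]
    congr 1; ring
  have h3 : ∫ t in Ioi (0:ℝ), H (-t) = (starRingEnd ℂ) J := by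
    rw [← h2, ← integral_conj]
    congr 1; ext t
    simp only [H]
    rw [← Complex.exp_conj]
    congr 1
    simp
  have h4 := integral_cexp_quadratic hb (-(Complex.I * x)) 0
  rw [show (∫ t : ℝ, Complex.exp (-1 * (t:ℂ) ^ 2 + (-(Complex.I * x)) * t + 0)) = ∫ t, H t from rfl, h1, h2, h3,
    Complex.add_conj] at h4
  have e1 : ((Real.pi : ℂ) / - -1) ^ (1 / 2 : ℂ) = ((Real.sqrt Real.pi : ℝ) : ℂ) := by
    rw [Real.sqrt_eq_rpow, Complex.ofReal_cpow Real.pi_pos.le]; simp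
  have e2 : Complex.exp (0 - (-(Complex.I * (x:ℂ))) ^ 2 / (4 * -1)) = ((Real.exp (-(x ^ 2) / 4) : ℝ) : ℂ) := by
    push_cast; congr 1
    rw [neg_sq, mul_pow, Complex.I_sq]; ring
  rw [e1, e2, ← Complex.ofReal_mul] at h4
  have h5 : 2 * J.re = Real.sqrt Real.pi * Real.exp (-(x ^ 2) / 4) := by exact_mod_cast h4
  have h6 : J.re = Real.sqrt Real.pi * Real.exp (-(x ^ 2) / 4) / 2 := by linarith
  rw [h6]
  unfold normalDensity
  have h7 : 0 < Real.sqrt Real.pi := Real.sqrt_pos.2 Real.pi_pos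
  have h8 : Real.sqrt Real.pi ^ 2 = Real.pi := Real.sq_sqrt Real.pi_pos.le
  rw [← h8]
  field_simp
  simp

lemma g_deriv (x : ℝ) : HasDerivAt normalDensity (-(x / 2) * normalDensity x) x := by
  have h1 : HasDerivAt (fun y : ℝ => -(y ^ 2) / 4) (-(2 * x) / 4) x := by
    have := ((hasDerivAt_pow 2 x).neg).div_const 4
    simpa using this
  have := h1.exp.const_mul (1 / (2 * Real.sqrt Real.pi))
  refine this.congr_deriv ?_
  unfold normalDensity; ring

lemma gx_eq (x : ℝ) : -(x / 2) * normalDensity x =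
    (1 / Real.pi) * (axInt x (fun ζ => -Complex.I * Complex.exp ζ * gsL ζ)).re := by
  have := re_deriv (ax_deriv gsL_diff.continuous decGG decGGx x)
  have h2 := g_deriv x
  rw [funext g_eq] at h2
  rw [← h2.unique this, g_eq]

/-! ### Symmetry -/

lemma ax_conj (a β x : ℝ) : axInt (-x) (fun ζ => Complex.exp (Lz a β ζ)) =
    (starRingEnd ℂ) (axInt x (fun ζ => Complex.exp (Lz a (-β) ζ))) := by
  unfold axInt
  rw [← integral_conj]
  congr 1; ext t
  rw [map_mul, ← Complex.exp_conj, ← Complex.exp_conj]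
  congr 2
  · simp
  · unfold Lz
    simp [← Complex.exp_conj]

lemma f_neg (a β x : ℝ) : stableDensity a β (-x) = stableDensity a (-β) x := by
  rw [stable_eq, stable_eq, ax_conj, Complex.conj_re]

lemma fAlpha_neg (a β x : ℝ) : fAlpha a β (-x) = fAlpha a (-β) x := by
  unfold fAlpha; simp_rw [f_neg]

lemma fX_neg (a β x : ℝ) : fX a β (-x) = -fX a (-β) x := by
  unfold fX
  have : stableDensity a (-β) = fun y => stableDensity a β (-y) := funext fun y => (f_neg a β y).symm
  rw [this, deriv_comp_neg, neg_neg]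

lemma fSig_neg (a β x : ℝ) : fSig a β (-x) = fSig a (-β) x := by
  unfold fSig; rw [f_neg, fX_neg]; ring
end

end Part3

section Part4

/-! ### Estimates along the ray -/

def RI (x : ℝ) (Ψ : ℂ → ℂ) : Prop := IntegrableOn (fun s : ℝ => (s : ℂ)⁻¹ *
    (Complex.exp (-(Complex.I * Complex.exp (ray s) * x)) * Ψ (ray s) * Complex.exp (ray s))) (Ioi 0)

lemma RI.addI {x : ℝ} {Ψ₁ Ψ₂ : ℂ → ℂ} (h1 : RI x Ψ₁) (h2 : RI x Ψ₂) :
    RI x (fun ζ => Ψ₁ ζ + Ψ₂ ζ) ∧ rayInt x (fun ζ => Ψ₁ ζ + Ψ₂ ζ) = rayInt x Ψ₁ + rayInt x Ψ₂ := by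
  have e : (fun s : ℝ => (s : ℂ)⁻¹ *
    (Complex.exp (-(Complex.I * Complex.exp (ray s) * x)) * (Ψ₁ (ray s) + Ψ₂ (ray s)) * Complex.exp (ray s))) =
    fun s : ℝ => (s : ℂ)⁻¹ *
    (Complex.exp (-(Complex.I * Complex.exp (ray s) * x)) * Ψ₁ (ray s) * Complex.exp (ray s)) + (s : ℂ)⁻¹ *
    (Complex.exp (-(Complex.I * Complex.exp (ray s) * x)) * Ψ₂ (ray s) * Complex.exp (ray s)) := by
    ext s; ring
  unfold RI rayInt
  rw [e]
  exact ⟨h1.add h2, integral_add h1 h2⟩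

lemma RI.mulI {x : ℝ} {Ψ : ℂ → ℂ} (h1 : RI x Ψ) (c : ℂ) :
    RI x (fun ζ => c * Ψ ζ) ∧ rayInt x (fun ζ => c * Ψ ζ) = c * rayInt x Ψ := by
  have e : (fun s : ℝ => (s : ℂ)⁻¹ *
    (Complex.exp (-(Complex.I * Complex.exp (ray s) * x)) * (c * Ψ (ray s)) * Complex.exp (ray s))) =
    fun s : ℝ => c * ((s : ℂ)⁻¹ *
    (Complex.exp (-(Complex.I * Complex.exp (ray s) * x)) * Ψ (ray s) * Complex.exp (ray s))) := by
    ext s; ring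
  refine ⟨?_, rayInt_const_mul x c Ψ⟩
  unfold RI
  rw [e]
  exact h1.const_mul c

lemma RI.ofBf {x : ℝ} (hx : 0 < x) {Ψ : ℂ → ℂ} (h1 : Continuous Ψ) {A₁ p A₂ q : ℝ} (hp : 0 ≤ p) (hq : 0 ≤ q)
    (hb : ∀ s, 0 < s → ‖Ψ (ray s)‖ ≤ Bf A₁ p A₂ q s) : RI x Ψ :=
  ray_int h1 (Bf_int hx hp hq) hb

lemma RI.pow {x : ℝ} (hx : 0 < x) {p : ℝ} (hp : 0 ≤ p) : RI x (fun ζ => Complex.exp ((p : ℂ) * ζ)) := by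
  refine RI.ofBf hx (by fun_prop) (A₁ := 1) (p := p) (A₂ := 0) (q := p) hp hp fun s hs => ?_
  rw [norm_exp_mul, ray_re]
  unfold Bf
  rw [mul_comm p, ← Real.rpow_def_of_pos hs]
  have : 0 ≤ s ^ (7:ℝ) := by positivity
  linarith

lemma re_pow3 {x : ℝ} (hx : 0 < x) : (rayInt x (fun ζ => Complex.exp (2 * ζ))).re = 0 := by
  have := rayInt_pow hx (a := 3) (by norm_num)
  rw [show ((3 - 1 : ℝ) : ℂ) = 2 by push_cast; norm_num] at this
  rw [this, Complex.re_ofReal_mul]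
  have e : (Complex.exp (-((Real.pi * 3 / 2 : ℝ):ℂ) * Complex.I)).re = 0 := by
    rw [Complex.exp_re]
    simp only [Complex.neg_re, Complex.mul_re, Complex.ofReal_re, Complex.I_re, Complex.neg_im,
      Complex.ofReal_im, Complex.I_im, Complex.mul_im]
    have : Real.cos (Real.pi * 3 / 2) = 0 := by
      rw [show Real.pi * 3 / 2 = Real.pi / 2 + Real.pi by ring, Real.cos_add_pi, Real.cos_pi_div_two, neg_zero]
    simp [this]
  rw [e, mul_zero]

lemma re_pow2 {x : ℝ} (hx : 0 < x) (c : ℝ) : ((Complex.I * c) * rayInt x (fun ζ => Complex.exp ζ)).re = 0 := by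
  have := rayInt_pow hx (a := 2) (by norm_num)
  rw [show ((2 - 1 : ℝ) : ℂ) = 1 by push_cast; norm_num] at this
  simp only [one_mul] at this
  have e : Complex.exp (-((Real.pi * 2 / 2 : ℝ):ℂ) * Complex.I) = -1 := by
    rw [show -((Real.pi * 2 / 2 : ℝ):ℂ) * Complex.I = -((Real.pi : ℂ) * Complex.I) by push_cast; ring,
      Complex.exp_neg, Complex.exp_pi_mul_I]; norm_num
  rw [this, e]
  generalize x ^ (-(2:ℝ)) * Real.Gamma 2 = r
  simp

/-- The tail term. -/
noncomputable def Jt (Δ β x : ℝ) : ℝ :=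
  (1 + β) * Real.sin (Real.pi * Δ / 2) * Real.Gamma (3 - Δ) * x ^ (-(3 - Δ))

lemma rayE {Δ β x : ℝ} (h : Par Δ β) (hx : 0 < x) : RI x (Ez (2 - Δ) β) ∧
    (rayInt x (Ez (2 - Δ) β)).re = Jt Δ β x := by
  have hΔ := h.h1
  have hΔ0 := h.h0
  have p1 : RI x (fun ζ => Complex.exp (((3 - Δ - 1 : ℝ) : ℂ) * ζ)) := RI.pow hx (by linarith)
  have p2 : RI x (fun ζ => Complex.exp (((2 : ℝ) : ℂ) * ζ)) := RI.pow hx (by norm_num)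
  have p3 : RI x (fun ζ => Complex.exp (((1 : ℝ) : ℂ) * ζ)) := RI.pow hx (by norm_num)
  simp only [Complex.ofReal_ofNat, Complex.ofReal_one, one_mul] at p2 p3
  obtain ⟨q1, v1⟩ := p1.mulI (-(1 + Complex.I * β * tauP (2 - Δ)))
  obtain ⟨q3, v3⟩ := p3.mulI (Complex.I * ((β * tauP (2 - Δ) : ℝ) : ℂ))
  obtain ⟨r1, w1⟩ := q1.addI q3
  obtain ⟨r2, w2⟩ := r1.addI p2
  have e : Ez (2 - Δ) β = fun ζ => -(1 + Complex.I * β * tauP (2 - Δ)) * Complex.exp (((3 - Δ - 1 : ℝ) : ℂ) * ζ) +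
      Complex.I * ((β * tauP (2 - Δ) : ℝ) : ℂ) * Complex.exp ζ + Complex.exp (2 * ζ) := by
    ext ζ
    unfold Ez Lz
    rw [show 3 - Δ - 1 = 2 - Δ by ring]
    push_cast
    ring
  rw [e]
  refine ⟨r2, ?_⟩
  rw [w2, w1, v1, v3, Complex.add_re, Complex.add_re, re_pow3 hx, re_pow2 hx, rayInt_pow hx (by linarith)]
  have e2 : Complex.exp (-((Real.pi * (3 - Δ) / 2 : ℝ):ℂ) * Complex.I) =
      -(Real.sin (Real.pi * Δ / 2) : ℝ) + Complex.I * (Real.cos (Real.pi * Δ / 2) : ℝ) := by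
    rw [show -((Real.pi * (3 - Δ) / 2 : ℝ):ℂ) * Complex.I = ((Real.pi * Δ / 2 - Real.pi / 2 - Real.pi : ℝ) : ℂ) * Complex.I by
      push_cast; ring, Complex.exp_mul_I, ← Complex.ofReal_cos, ← Complex.ofReal_sin, Real.cos_sub_pi, Real.sin_sub_pi,
      Real.cos_sub_pi_div_two, Real.sin_sub_pi_div_two]
    push_cast; ring
  rw [e2]
  have hc : Real.cos (Real.pi * Δ / 2) ≠ 0 := by
    refine (Real.cos_pos_of_mem_Ioo ⟨?_, ?_⟩).ne' <;> nlinarith [Real.pi_pos]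
  have e3 : tauP (2 - Δ) * Real.cos (Real.pi * Δ / 2) = Real.sin (Real.pi * Δ / 2) := by
    rw [tauP_eq, Real.tan_mul_cos hc]
  have e4 : Jt Δ β x = (1 + β) * Real.sin (Real.pi * Δ / 2) * (x ^ (-(3 - Δ)) * Real.Gamma (3 - Δ)) := by
    unfold Jt; ring
  rw [e4]
  generalize x ^ (-(3 - Δ)) * Real.Gamma (3 - Δ) = r
  generalize Real.sin (Real.pi * Δ / 2) = S at *
  generalize Real.cos (Real.pi * Δ / 2) = T at *
  generalize tauP (2 - Δ) = τ at *
  simp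
  linear_combination (β * r) * e3

lemma rayD1 {Δ β x : ℝ} (h : Par Δ β) (h0 : 0 < Δ) (hx : 0 < x) : RI x (D1z Δ β) ∧
    (rayInt x (D1z Δ β)).re = -(Jt Δ β x / Δ) := by
  obtain ⟨r, v⟩ := rayE h hx
  have p3 : RI x (fun ζ => Complex.exp (((1 : ℝ) : ℂ) * ζ)) := RI.pow hx (by norm_num)
  simp only [Complex.ofReal_one, one_mul] at p3
  obtain ⟨q1, v1⟩ := r.mulI (((-(1 / Δ) : ℝ)) : ℂ)
  obtain ⟨q3, v3⟩ := p3.mulI (Complex.I * ((β * (tauD (2 - Δ) + tauP (2 - Δ) / Δ) : ℝ) : ℂ))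
  obtain ⟨r1, w1⟩ := q1.addI q3
  have e : D1z Δ β = fun ζ => ((-(1 / Δ) : ℝ) : ℂ) * Ez (2 - Δ) β ζ +
      Complex.I * ((β * (tauD (2 - Δ) + tauP (2 - Δ) / Δ) : ℝ) : ℂ) * Complex.exp ζ := by
    ext ζ
    unfold D1z
    push_cast
    ring
  rw [e]
  refine ⟨r1, ?_⟩
  rw [w1, v1, v3, Complex.add_re, re_pow2 hx, Complex.re_ofReal_mul, v]
  ring

/-! ### Power comparisons -/

lemma npw {y : ℝ} (hy : 0 ≤ y) {a k b : ℕ} (h1 : a ≤ k) (h2 : k ≤ b) : y ^ k ≤ y ^ a + y ^ b := by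
  rcases le_total y 1 with h | h
  · have := pow_le_pow_of_le_one hy h h1
    have : 0 ≤ y ^ b := by positivity
    linarith
  · have := pow_le_pow_right₀ h h2
    have : 0 ≤ y ^ a := by positivity
    linarith

lemma halfpow {s : ℝ} (hs : 0 < s) : ∃ y : ℝ, 0 < y ∧ s = y ^ 2 ∧ (∀ k : ℕ, s ^ ((k:ℝ) / 2) = y ^ k) ∧
    Real.exp (ray s).re = y ^ 2 ∧ Real.exp (3 / 2 * (ray s).re) = y ^ 3 ∧ Real.exp (3 * (ray s).re) = y ^ 6 := by
  refine ⟨Real.sqrt s, Real.sqrt_pos.2 hs, (Real.sq_sqrt hs.le).symm, ?_⟩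
  have hk : ∀ k : ℕ, s ^ ((k:ℝ) / 2) = Real.sqrt s ^ k := by
    intro k
    rw [Real.sqrt_eq_rpow, ← Real.rpow_natCast, ← Real.rpow_mul hs.le]
    congr 1; ring
  refine ⟨hk, ?_, ?_, ?_⟩
  · rw [ray_re, Real.exp_log hs, Real.sq_sqrt hs.le]
  · rw [ray_re, ← hk, Real.rpow_def_of_pos hs]; congr 1; push_cast; ring
  · rw [ray_re, ← hk, Real.rpow_def_of_pos hs]; congr 1; push_cast; ring

lemma Par.rays {Δ β : ℝ} (h : Par Δ β) (s : ℝ) : Strip Δ β (ray s) :=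
  ⟨h.h0, h.h1, h.hb, by rw [ray_im]; linarith [Real.pi_pos], by rw [ray_im]⟩

lemma exp8 (s : ℝ) (hs : 0 ≤ s) : Real.exp (2 - s / 8) ≤ 8 :=
  (Real.exp_le_exp.2 (by linarith)).trans exp_two_lt.le

section
variable {Δ β : ℝ}

lemma bdDiff (h : Par Δ β) (s : ℝ) (hs : 0 < s) :
    ‖stL Δ β (ray s) - gsL (ray s)‖ ≤ Bf (4800 * Δ) 1 0 1 s := by
  obtain ⟨y, hy, e1, ek, e2, e3, e6⟩ := halfpow hs
  have hb := (h.rays s).P5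
  rw [e2, e6] at hb
  have h8 := exp8 (y ^ 2) (by positivity)
  have k2 : s ^ (1:ℝ) = y ^ 2 := by rw [← ek]; norm_num
  have k14 : s ^ (7:ℝ) = y ^ 14 := by rw [← ek]; norm_num
  unfold Bf
  rw [k2, k14]
  have hΔ := h.h0
  have n1 := npw hy.le (show 2 ≤ 6 by norm_num) (show 6 ≤ 14 by norm_num)
  calc _ ≤ _ := hb
    _ ≤ 8 * (300 * Δ * (y ^ 2 + y ^ 6)) := by gcongr
    _ ≤ 8 * (300 * Δ * (2 * (y ^ 2 + y ^ 14))) := by gcongr; nlinarith [pow_pos hy 14]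
    _ = _ := by ring

lemma bdDiffx (h : Par Δ β) (s : ℝ) (hs : 0 < s) :
    ‖-Complex.I * Complex.exp (ray s) * (stL Δ β (ray s) - gsL (ray s))‖ ≤ Bf (4800 * Δ) 2 0 2 s := by
  obtain ⟨y, hy, e1, ek, e2, e3, e6⟩ := halfpow hs
  have hb := (h.rays s).P5
  rw [norm_mIz]
  rw [e2, e6] at hb
  rw [e2]
  have h8 := exp8 (y ^ 2) (by positivity)
  have k4 : s ^ (2:ℝ) = y ^ 4 := by rw [← ek]; norm_num
  have k14 : s ^ (7:ℝ) = y ^ 14 := by rw [← ek]; norm_num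
  unfold Bf
  rw [k14, k4]
  have hΔ := h.h0
  have n1 := npw hy.le (show 4 ≤ 8 by norm_num) (show 8 ≤ 14 by norm_num)
  calc _ ≤ y ^ 2 * _ := mul_le_mul_of_nonneg_left hb (by positivity)
    _ ≤ y ^ 2 * (8 * (300 * Δ * (y ^ 2 + y ^ 6))) := by gcongr
    _ = 8 * (300 * Δ * (y ^ 4 + y ^ 8)) := by ring
    _ ≤ 8 * (300 * Δ * (2 * (y ^ 4 + y ^ 14))) := by gcongr; nlinarith [pow_pos hy 14]
    _ = _ := by ring

lemma bdA (h : Par Δ β) (s : ℝ) (hs : 0 < s) :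
    ‖stL Δ β (ray s) - gsL (ray s) - Ez (2 - Δ) β (ray s)‖ ≤
      Bf (14400 * Δ ^ 2) 2 (43200 * Δ) (5/2) s := by
  obtain ⟨y, hy, e1, ek, e2, e3, e6⟩ := halfpow hs
  have hb := (h.rays s).P6
  rw [e2, e6, e3] at hb
  have k4 : s ^ (2:ℝ) = y ^ 4 := by rw [← ek]; norm_num
  have k5 : s ^ (5/2:ℝ) = y ^ 5 := by rw [← ek]; norm_num
  have k14 : s ^ (7:ℝ) = y ^ 14 := by rw [← ek]; norm_num
  unfold Bf
  rw [k14, k5, k4]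
  have hΔ := h.h0
  have n1 := npw hy.le (show 4 ≤ 8 by norm_num) (show 8 ≤ 14 by norm_num)
  have n2 := npw hy.le (show 5 ≤ 9 by norm_num) (show 9 ≤ 14 by norm_num)
  have n3 := npw hy.le (show 5 ≤ 8 by norm_num) (show 8 ≤ 14 by norm_num)
  have n4 := npw hy.le (show 5 ≤ 12 by norm_num) (show 12 ≤ 14 by norm_num)
  have n5 := pow_pos hy 14
  have n6 := pow_pos hy 5
  calc _ ≤ _ := hb
    _ = 7200 * Δ * (Δ * (y ^ 4 + y ^ 8) + (y ^ 5 + y ^ 9 + y ^ 8 + y ^ 12)) := by ring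
    _ ≤ 7200 * Δ * (Δ * (2 * (y ^ 4 + y ^ 14)) + (6 * (y ^ 5 + y ^ 14))) := by
      gcongr
      · linarith
      · linarith
    _ = _ := by ring

lemma bdR (h : Par Δ β) (h0 : 0 < Δ) (s : ℝ) (hs : 0 < s) :
    ‖Dz (2 - Δ) β (ray s) * stL Δ β (ray s) - D1z Δ β (ray s)‖ ≤
      Bf (100000 * Δ) (3/2) 100000 (5/2) s := by
  obtain ⟨y, hy, e1, ek, e2, e3, e6⟩ := halfpow hs
  have hst := h.rays s
  have hb1 := hst.DD1 h0
  have hb2 := hst.D1bd h0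
  have hb3 := hst.P7
  have hb4 := hst.expL
  have h8 := exp8 (y ^ 2) (by positivity)
  rw [e6] at hb1 hb2 hb3
  rw [e2] at hb2 hb3 hb4
  rw [e3] at hb1 hb3
  have k3 : s ^ (3/2:ℝ) = y ^ 3 := by rw [← ek]; norm_num
  have k5 : s ^ (5/2:ℝ) = y ^ 5 := by rw [← ek]; norm_num
  have k14 : s ^ (7:ℝ) = y ^ 14 := by rw [← ek]; norm_num
  unfold Bf
  rw [k14, k5, k3]
  have n1 := npw hy.le (show 3 ≤ 6 by norm_num) (show 6 ≤ 14 by norm_num)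
  have n1' := npw hy.le (show 3 ≤ 4 by norm_num) (show 4 ≤ 14 by norm_num)
  have n1'' := npw hy.le (show 3 ≤ 8 by norm_num) (show 8 ≤ 14 by norm_num)
  have n2 := npw hy.le (show 5 ≤ 9 by norm_num) (show 9 ≤ 14 by norm_num)
  have n3 := npw hy.le (show 5 ≤ 8 by norm_num) (show 8 ≤ 14 by norm_num)
  have n4 := npw hy.le (show 5 ≤ 12 by norm_num) (show 12 ≤ 14 by norm_num)
  have n5 := pow_pos hy 14
  have n6 := pow_pos hy 5
  have n7 := pow_pos hy 3
  have e : Dz (2 - Δ) β (ray s) * stL Δ β (ray s) - D1z Δ β (ray s) =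
      (Dz (2 - Δ) β (ray s) - D1z Δ β (ray s)) * Complex.exp (Lz (2 - Δ) β (ray s)) +
       D1z Δ β (ray s) * (Complex.exp (Lz (2 - Δ) β (ray s)) - 1) := by unfold stL; ring
  rw [e]
  calc _ ≤ ‖Dz (2 - Δ) β (ray s) - D1z Δ β (ray s)‖ * ‖Complex.exp (Lz (2 - Δ) β (ray s))‖ +
        ‖D1z Δ β (ray s)‖ * ‖Complex.exp (Lz (2 - Δ) β (ray s)) - 1‖ := by
        refine (norm_add_le _ _).trans ?_
        rw [norm_mul, norm_mul]
    _ ≤ (300 * Δ * (y ^ 3 + y ^ 6)) * 8 + (400 * (y ^ 2 + y ^ 6)) * (8 * (2 * (Δ * y ^ 2 + y ^ 3 + y ^ 6))) := by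
        gcongr
        exact hb4.trans h8
    _ = Δ * (2400 * (y ^ 3 + y ^ 6) + 6400 * (y ^ 4 + y ^ 8)) + 6400 * (y ^ 5 + y ^ 9 + y ^ 8 + y ^ 12) := by ring
    _ ≤ Δ * (100000 * (y ^ 3 + y ^ 14)) + 100000 * (y ^ 5 + y ^ 14) :=
      add_le_add (mul_le_mul_of_nonneg_left (by linarith) h0.le) (by linarith)
    _ = _ := by ring

end

end Part4

section Part5

/-! ### Density estimates -/

lemma ax_rot {Φ : ℂ → ℂ} (hd : Differentiable ℂ Φ) {C : ℝ} (h : Dec C Φ) {x : ℝ} (hx : 0 ≤ x) :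
    axInt x Φ = rayInt x Φ := rot hd h hx

lemma pi_inv_le : 1 / Real.pi ≤ 1 := by
  rw [div_le_one Real.pi_pos]; linarith [Real.pi_gt_three]

lemma abs_pi_re (z : ℂ) : |(1 / Real.pi) * z.re| ≤ ‖z‖ := by
  rw [abs_mul, abs_of_pos (by positivity)]
  have := Complex.abs_re_le_norm z
  nlinarith [pi_inv_le, abs_nonneg z.re]

section
variable {Δ β : ℝ}

lemma fg_eq (h : Par Δ β) (x : ℝ) : stableDensity (2 - Δ) β x - normalDensity x =
    (1 / Real.pi) * (axInt x (fun ζ => stL Δ β ζ - gsL ζ)).re := by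
  rw [f_eq, g_eq, ax_sub (stL_diff Δ β).continuous h.decGL gsL_diff.continuous decGG, Complex.sub_re]; ring

lemma diff_diff (Δ β : ℝ) : Differentiable ℂ (fun ζ => stL Δ β ζ - gsL ζ) := (stL_diff Δ β).sub gsL_diff

lemma diffx_diff (Δ β : ℝ) : Differentiable ℂ (fun ζ => -Complex.I * Complex.exp ζ * (stL Δ β ζ - gsL ζ)) := by
  have := diff_diff Δ β
  fun_prop

lemma Par.decDiffx (h : Par Δ β) : Dec (2 * 10 ^ 8) (fun ζ => -Complex.I * Complex.exp ζ * (stL Δ β ζ - gsL ζ)) := by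
  intro ζ h1 h2
  have e1 := h.decGLx ζ h1 h2
  have e2 := decGGx ζ h1 h2
  simp only at e1 e2 ⊢
  rw [mul_sub]
  refine (norm_sub_le _ _).trans ?_
  linarith

lemma fgx_eq (h : Par Δ β) (x : ℝ) : fX (2 - Δ) β x + x / 2 * normalDensity x =
    (1 / Real.pi) * (axInt x (fun ζ => -Complex.I * Complex.exp ζ * (stL Δ β ζ - gsL ζ))).re := by
  have := gx_eq x
  have hc := (stL_diff Δ β).continuous
  have hc2 := gsL_diff.continuous
  have e := ax_sub (Φ := fun ζ => -Complex.I * Complex.exp ζ * stL Δ β ζ)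
    (Φ' := fun ζ => -Complex.I * Complex.exp ζ * gsL ζ) (by fun_prop) h.decGLx (by fun_prop) decGGx x
  rw [show (fun ζ => -Complex.I * Complex.exp ζ * (stL Δ β ζ - gsL ζ)) =
    fun ζ => -Complex.I * Complex.exp ζ * stL Δ β ζ - -Complex.I * Complex.exp ζ * gsL ζ by
    ext ζ; ring, e, Complex.sub_re, mul_sub, ← h.fX_eq, ← this]
  ring

lemma est_all (h : Par Δ β) (h0 : 0 < Δ) (h1 : Δ < 1 / 100) (x : ℝ) :
    |stableDensity (2 - Δ) β x - normalDensity x| ≤ 10 ^ 12 * Δ ∧ |fX (2 - Δ) β x| ≤ 10 ^ 12 ∧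
    |fAlpha (2 - Δ) β x| ≤ 10 ^ 12 := by
  refine ⟨?_, ?_, ?_⟩
  · rw [fg_eq h]
    have := (abs_pi_re _).trans (ax_bound h.decDiff x)
    linarith
  · rw [h.fX_eq]
    have := (abs_pi_re _).trans (ax_bound h.decGLx x)
    linarith
  · rw [fAlpha_eq h h0 h1]
    have := (abs_pi_re _).trans (ax_bound h.decD x)
    linarith

/-- Amplitude of the tail. -/
noncomputable def Am (Δ : ℝ) : ℝ := Real.sin (Real.pi * Δ / 2) / (Real.pi * Δ) * Real.Gamma (3 - Δ)

lemma Jt_eq (h0 : 0 < Δ) (β : ℝ) {x : ℝ} (hx : 0 < x) : Jt Δ β x / Real.pi = Δ * ((1 + β) * Am Δ * x ^ Δ * x ^ (-3 : ℝ)) := by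
  unfold Jt Am
  rw [show -(3 - Δ) = Δ + (-3) by ring, Real.rpow_add hx]
  have := Real.pi_pos
  field_simp

lemma Am_bound : ∃ C : ℝ, 0 < C ∧ ∀ᶠ Δ in 𝓝[>] (0:ℝ), |Am Δ - 1| ≤ C * Δ := by
  have hG : DifferentiableAt ℝ Real.Gamma 3 := by
    refine Real.differentiableAt_Gamma fun m => ?_
    have : (0:ℝ) ≤ m := Nat.cast_nonneg m
    intro h; linarith
  have h1 : DifferentiableAt ℝ (fun Δ : ℝ => Real.Gamma (3 - Δ)) 0 := by
    have : DifferentiableAt ℝ Real.Gamma (3 - 0) := by simpa using hG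
    exact this.comp (0:ℝ) (by fun_prop : DifferentiableAt ℝ (fun Δ : ℝ => 3 - Δ) 0)
  have h2 := h1.hasDerivAt.isBigO_sub
  obtain ⟨C, hC, hb⟩ := h2.exists_pos
  have hb := hb.bound
  have G3 : Real.Gamma 3 = 2 := by
    have := Real.Gamma_nat_eq_factorial 2
    rw [show ((2:ℕ):ℝ) + 1 = 3 by norm_num] at this
    rw [this]; norm_num [Nat.factorial]
  refine ⟨C + 20, by positivity, ?_⟩
  have hsmall : ∀ᶠ Δ in 𝓝[>] (0:ℝ), Δ < 1/100 ∧ 0 < Δ := by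
    filter_upwards [Ioo_mem_nhdsGT (show (0:ℝ) < 1/100 by norm_num)] with Δ hΔ
    exact ⟨hΔ.2, hΔ.1⟩
  filter_upwards [nhdsWithin_le_nhds hb, hsmall] with Δ hΔ ⟨hs, h0⟩
  simp only [sub_zero, G3, Real.norm_eq_abs, abs_of_pos h0] at hΔ
  have pp := Real.pi_pos
  have p4 := Real.pi_lt_four
  set φ := Real.pi * Δ / 2 with hφ
  have hφ0 : 0 < φ := by positivity
  have hφ1 : φ ≤ 2 * Δ := by nlinarith
  have s1 : Real.sin φ < φ := Real.sin_lt hφ0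
  have s2 : φ - φ ^ 3 / 4 < Real.sin φ := by
    have := Real.sin_gt_sub_cube hφ0
    have : 0 < φ ^ 3 := by positivity
    linarith
  have e : Am Δ = (Real.sin φ / φ) / 2 * Real.Gamma (3 - Δ) := by
    unfold Am
    rw [← hφ, show Real.pi * Δ = 2 * φ by rw [hφ]; ring]
    field_simp
  set r := Real.sin φ / φ with hr
  have r1 : r ≤ 1 := by rw [hr, div_le_one hφ0]; exact s1.le
  have r2 : 1 - φ ^ 2 / 4 ≤ r := by
    rw [hr, le_div_iff₀ hφ0]; nlinarith
  have r3 : 1 - Δ ≤ r := by nlinarith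
  rw [e]
  rw [abs_le] at hΔ ⊢
  have hC' : 0 ≤ C * Δ := by positivity
  constructor <;> nlinarith

lemma rpow_sub_one {x : ℝ} (hx : 1 ≤ x) (h0 : 0 ≤ Δ) (h1 : Δ ≤ 1 / 4) :
    1 ≤ x ^ Δ ∧ x ^ Δ - 1 ≤ 4 * Δ * x ^ (1 / 2 : ℝ) := by
  have hx0 : 0 < x := by linarith
  refine ⟨Real.one_le_rpow hx h0, ?_⟩
  have l1 : Real.log x ≤ x ^ (1 / 4 : ℝ) / (1 / 4) := Real.log_le_rpow_div hx0.le (by norm_num)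
  have l0 : 0 ≤ Real.log x := Real.log_nonneg hx
  have a1 : x ^ Δ ≤ x ^ (1 / 4 : ℝ) := Real.rpow_le_rpow_of_exponent_le hx h1
  have a2 : x ^ (1 / 4 : ℝ) * x ^ (1 / 4 : ℝ) = x ^ (1 / 2 : ℝ) := by
    rw [← Real.rpow_add hx0]; norm_num
  have a3 : x ^ Δ - 1 ≤ x ^ Δ * (Real.log x * Δ) := by
    have h := Real.add_one_le_exp (-(Real.log x * Δ))
    have e : x ^ Δ * Real.exp (-(Real.log x * Δ)) = 1 := by
      rw [Real.rpow_def_of_pos hx0, ← Real.exp_add]; simp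
    have p : 0 < x ^ Δ := by positivity
    nlinarith
  calc _ ≤ _ := a3
    _ ≤ x ^ (1 / 4 : ℝ) * (x ^ (1 / 4 : ℝ) / (1 / 4) * Δ) := by gcongr
    _ = _ := by rw [← a2]; ring

set_option maxHeartbeats 1000000 in
lemma est_tail : ∃ C : ℝ, 0 < C ∧ ∀ᶠ Δ in 𝓝[>] (0:ℝ), ∀ β x : ℝ, |β| ≤ 1 → 1 ≤ x →
    |stableDensity (2 - Δ) β x - normalDensity x| ≤ C * Δ * x ^ (-2 : ℝ) ∧
    |fX (2 - Δ) β x + x / 2 * normalDensity x| ≤ C * Δ * x ^ (-3 : ℝ) ∧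
    |fAlpha (2 - Δ) β x + (1 + β) * x ^ (-3 : ℝ)| ≤ C * (Δ * x ^ (-(5/2) : ℝ) + x ^ (-(7/2) : ℝ)) ∧
    normalDensity x + (3 / 4) * (1 + β) * Δ * x ^ (-3 : ℝ) - C * Δ * (Δ * x ^ (-3 : ℝ) + x ^ (-(7/2) : ℝ)) ≤
      stableDensity (2 - Δ) β x := by
  obtain ⟨CA, hCA, hA⟩ := Am_bound
  obtain ⟨K1, k1, b1⟩ := Bf_bound 1 1 (by norm_num) (by norm_num) (by norm_num) (by norm_num)
  obtain ⟨K2, k2, b2⟩ := Bf_bound 2 2 (by norm_num) (by norm_num) (by norm_num) (by norm_num)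
  obtain ⟨K3, k3, b3⟩ := Bf_bound 2 (5/2) (by norm_num) (by norm_num) (by norm_num) (by norm_num)
  obtain ⟨K4, k4, b4⟩ := Bf_bound (3/2) (5/2) (by norm_num) (by norm_num) (by norm_num) (by norm_num)
  set C := 100000 * (K1 + K2 + K3 + K4 + CA + 1) with hC
  refine ⟨C, by positivity, ?_⟩
  have hsm : (0:ℝ) < min (1/100) (1 / (8 * (CA + 1))) := by positivity
  filter_upwards [hA, Ioo_mem_nhdsGT hsm] with Δ hAΔ hΔ β x hβ hx
  have h0 : 0 < Δ := hΔ.1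
  have h1 : Δ < 1 / 100 := hΔ.2.trans_le (min_le_left _ _)
  have h2 : CA * Δ ≤ 1 / 8 := by
    have := hΔ.2.trans_le (min_le_right _ _)
    rw [lt_div_iff₀ (by positivity)] at this
    nlinarith
  have h : Par Δ β := ⟨h0.le, h1.le, hβ⟩
  have hx0 : 0 < x := by linarith
  have hβ' := abs_le.1 hβ
  obtain ⟨y1, y2⟩ := rpow_sub_one hx h0.le (by linarith)
  have m3 : 0 < x ^ (-3 : ℝ) := by positivity
  have m52 : 0 < x ^ (-(5/2) : ℝ) := by positivity
  have m72 : 0 < x ^ (-(7/2) : ℝ) := by positivity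
  have m2 : 0 < x ^ (-2 : ℝ) := by positivity
  have c1 := b1 (4800 * Δ) 0 x (by positivity) le_rfl hx
  have c2 := b2 (4800 * Δ) 0 x (by positivity) le_rfl hx
  have c3 := b3 (14400 * Δ ^ 2) (43200 * Δ) x (by positivity) (by positivity) hx
  have c4 := b4 (100000 * Δ) 100000 x (by positivity) (by positivity) hx
  rw [show (-(1 + 1) : ℝ) = -2 by norm_num] at c1
  rw [show (-(2 + 1) : ℝ) = -3 by norm_num] at c2 c3
  rw [show (-(5/2 + 1) : ℝ) = -(7/2) by norm_num] at c3 c4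
  rw [show (-(3/2 + 1) : ℝ) = -(5/2) by norm_num] at c4
  rw [abs_le] at hAΔ
  have hJ := Jt_eq h0 β hx0
  have hrE := rayE h hx0
  have hrD := rayD1 h h0 hx0
  refine ⟨?_, ?_, ?_, ?_⟩
  · rw [fg_eq h, ax_rot (diff_diff Δ β) h.decDiff hx0.le]
    refine (abs_pi_re _).trans ((ray_bound (Bf_int hx0 (by norm_num) (by norm_num)) (bdDiff h)).trans (c1.trans ?_))
    have : 0 ≤ Δ * x ^ (-2 : ℝ) := by positivity
    have e : C * Δ * x ^ (-2:ℝ) = C * (Δ * x ^ (-2:ℝ)) := by ring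
    rw [e, show K1 * (4800 * Δ * x ^ (-2:ℝ) + 0 * x ^ (-2:ℝ)) = (4800 * K1) * (Δ * x ^ (-2:ℝ)) by ring]
    exact mul_le_mul_of_nonneg_right (by rw [hC]; linarith) this
  · rw [fgx_eq h, ax_rot (diffx_diff Δ β) h.decDiffx hx0.le]
    refine (abs_pi_re _).trans ((ray_bound (Bf_int hx0 (by norm_num) (by norm_num)) (bdDiffx h)).trans (c2.trans ?_))
    have : 0 ≤ Δ * x ^ (-3 : ℝ) := by positivity
    have e : C * Δ * x ^ (-3:ℝ) = C * (Δ * x ^ (-3:ℝ)) := by ring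
    rw [e, show K2 * (4800 * Δ * x ^ (-3:ℝ) + 0 * x ^ (-3:ℝ)) = (4800 * K2) * (Δ * x ^ (-3:ℝ)) by ring]
    exact mul_le_mul_of_nonneg_right (by rw [hC]; linarith) this
  · -- derivative in the exponent
    set R : ℂ → ℂ := fun ζ => Dz (2 - Δ) β ζ * stL Δ β ζ - D1z Δ β ζ with hR
    have hRc : Continuous R := ((Dz_diff _ _).continuous.mul (stL_diff _ _).continuous).sub (D1z_diff _ _).continuous
    have hRI : RI x R := RI.ofBf hx0 hRc (by norm_num) (by norm_num) (bdR h h0)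
    have hRb := (abs_pi_re (rayInt x R)).trans
      ((ray_bound (Ψ := R) (Bf_int hx0 (by norm_num) (by norm_num)) (bdR h h0)).trans c4)
    have e1 : fAlpha (2 - Δ) β x = (1 / Real.pi) * (rayInt x R).re - Jt Δ β x / Real.pi / Δ := by
      rw [fAlpha_eq h h0 h1, ax_rot (Φ := fun ζ => Dz (2 - Δ) β ζ * stL Δ β ζ) ((Dz_diff _ _).mul (stL_diff _ _)) h.decD hx0.le]
      have := (hRI.addI hrD.1).2
      rw [show (fun ζ => R ζ + D1z Δ β ζ) = fun ζ => Dz (2 - Δ) β ζ * stL Δ β ζ by ext ζ; simp [hR]] at this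
      rw [this, Complex.add_re, hrD.2]
      ring
    rw [e1, hJ]
    have hy3 : x ^ (1/2 : ℝ) * x ^ (-3 : ℝ) = x ^ (-(5/2) : ℝ) := by rw [← Real.rpow_add hx0]; norm_num
    have h35 : x ^ (-3 : ℝ) ≤ x ^ (-(5/2) : ℝ) := Real.rpow_le_rpow_of_exponent_le hx (by norm_num)
    have e2 : (1 / Real.pi) * (rayInt x R).re - Δ * ((1 + β) * Am Δ * x ^ Δ * x ^ (-3 : ℝ)) / Δ + (1 + β) * x ^ (-3:ℝ) =
      (1 / Real.pi) * (rayInt x R).re - (1 + β) * (((Am Δ - 1) + Am Δ * (x ^ Δ - 1)) * x ^ (-3:ℝ)) := by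
      field_simp; ring
    rw [e2]
    have a1 : |((Am Δ - 1) + Am Δ * (x ^ Δ - 1)) * x ^ (-3:ℝ)| ≤ (CA + 8) * (Δ * x ^ (-(5/2):ℝ)) := by
      rw [abs_mul, abs_of_pos m3]
      have hA2 : |Am Δ| ≤ 2 := abs_le.2 ⟨by linarith, by linarith⟩
      have : |(Am Δ - 1) + Am Δ * (x ^ Δ - 1)| ≤ CA * Δ + 2 * (4 * Δ * x ^ (1 / 2 : ℝ)) := by
        refine (abs_add_le _ _).trans (add_le_add (abs_le.2 hAΔ) ?_)
        rw [abs_mul, abs_of_nonneg (by linarith : 0 ≤ x ^ Δ - 1)]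
        gcongr
      calc _ ≤ (CA * Δ + 2 * (4 * Δ * x ^ (1 / 2 : ℝ))) * x ^ (-3:ℝ) := by gcongr
        _ = CA * Δ * x ^ (-3:ℝ) + 8 * Δ * x ^ (-(5/2):ℝ) := by rw [← hy3]; ring
        _ ≤ CA * Δ * x ^ (-(5/2):ℝ) + 8 * Δ * x ^ (-(5/2):ℝ) := by gcongr
        _ = _ := by ring
    have a2 : |(1 + β) * (((Am Δ - 1) + Am Δ * (x ^ Δ - 1)) * x ^ (-3:ℝ))| ≤ 2 * ((CA + 8) * (Δ * x ^ (-(5/2):ℝ))) := by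
      rw [abs_mul]
      gcongr
      rw [abs_le]; constructor <;> linarith
    have := (abs_sub _ _).trans (add_le_add hRb a2)
    refine this.trans ?_
    have p1 : 0 ≤ Δ * x ^ (-(5/2) : ℝ) := by positivity
    rw [show K4 * (100000 * Δ * x ^ (-(5/2):ℝ) + 100000 * x ^ (-(7/2):ℝ)) + 2 * ((CA + 8) * (Δ * x ^ (-(5/2):ℝ)))
      = (100000 * K4 + 2 * (CA + 8)) * (Δ * x ^ (-(5/2):ℝ)) + (100000 * K4) * x ^ (-(7/2):ℝ) by ring,
      mul_add C]
    refine add_le_add (mul_le_mul_of_nonneg_right ?_ p1) (mul_le_mul_of_nonneg_right ?_ m72.le) <;> (rw [hC]; linarith)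
  · set R : ℂ → ℂ := fun ζ => stL Δ β ζ - gsL ζ - Ez (2 - Δ) β ζ with hR
    have hRc : Continuous R := ((stL_diff _ _).continuous.sub gsL_diff.continuous).sub (Ez_diff _ _).continuous
    have hRI : RI x R := RI.ofBf hx0 hRc (by norm_num) (by norm_num) (bdA h)
    have hRb := (abs_pi_re (rayInt x R)).trans
      ((ray_bound (Ψ := R) (Bf_int hx0 (by norm_num) (by norm_num)) (bdA h)).trans c3)
    have e1 : stableDensity (2 - Δ) β x - normalDensity x = (1 / Real.pi) * (rayInt x R).re + Jt Δ β x / Real.pi := by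
      rw [fg_eq h, ax_rot (diff_diff Δ β) h.decDiff hx0.le]
      have := (hRI.addI hrE.1).2
      rw [show (fun ζ => R ζ + Ez (2 - Δ) β ζ) = fun ζ => stL Δ β ζ - gsL ζ by ext ζ; simp [hR]] at this
      rw [this, Complex.add_re, hrE.2]
      ring
    rw [hJ] at e1
    have a1 : (3 / 4) * (1 + β) * Δ * x ^ (-3 : ℝ) ≤ Δ * ((1 + β) * Am Δ * x ^ Δ * x ^ (-3 : ℝ)) := by
      have : 3 / 4 ≤ Am Δ * x ^ Δ := by nlinarith
      have p : 0 ≤ (1 + β) * Δ * x ^ (-3:ℝ) := by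
        have : 0 ≤ 1 + β := by linarith
        positivity
      nlinarith
    have a2 := (abs_le.1 hRb).1
    have p1 : 0 ≤ Δ * (Δ * x ^ (-3 : ℝ)) := by positivity
    have p2 : 0 ≤ Δ * x ^ (-(7/2) : ℝ) := by positivity
    have a3 : K3 * (14400 * Δ ^ 2 * x ^ (-3:ℝ) + 43200 * Δ * x ^ (-(7/2):ℝ)) ≤
        C * Δ * (Δ * x ^ (-3 : ℝ) + x ^ (-(7/2) : ℝ)) := by
      rw [show K3 * (14400 * Δ ^ 2 * x ^ (-3:ℝ) + 43200 * Δ * x ^ (-(7/2):ℝ)) =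
        (14400 * K3) * (Δ * (Δ * x ^ (-3 : ℝ))) + (43200 * K3) * (Δ * x ^ (-(7/2) : ℝ)) by ring,
        show C * Δ * (Δ * x ^ (-3 : ℝ) + x ^ (-(7/2) : ℝ)) = C * (Δ * (Δ * x ^ (-3 : ℝ))) + C * (Δ * x ^ (-(7/2) : ℝ)) by ring]
      refine add_le_add (mul_le_mul_of_nonneg_right ?_ p1) (mul_le_mul_of_nonneg_right ?_ p2) <;> (rw [hC]; linarith)
    linarith
end

end Part5

section Part6

section P6

set_option maxHeartbeats 1000000 in
lemma pwA {f g S A C Δ r x q γ b : ℝ} (hC : 0 < C) (hr : 0 < r) (hr1 : r ≤ 1) (hxr : x * r ^ 2 = 1)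
    (hq : 0 < q) (hq1 : q ≤ 1) (hqx : q * x ≤ 1) (hΔ : Δ = q ^ 2) (hγ : 0 < γ) (hb0 : 0 ≤ b) (hb2 : b ≤ 2)
    (hg : γ * q ≤ g) (hfg : g ≤ f) (h1 : |f - g| ≤ C * Δ * r ^ 4)
    (hS : |S - (x ^ 2 / 2 - 1) * g| ≤ 2 * C * Δ * r ^ 4)
    (hA : |A + b * r ^ 6| ≤ C * (Δ * r ^ 5 + r ^ 7)) :
    |S * A / f + b / (2 * x)| ≤ 2 * (1 + 3 * C / γ) * (1 + C) * r ^ 3 := by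
  have hx : 1 ≤ x := by nlinarith [mul_le_one₀ hr1 hr.le hr1, sq_nonneg r, pow_pos hr 2]
  have hgp : 0 < g := lt_of_lt_of_le (by positivity) hg
  have hf : 0 < f := hgp.trans_le hfg
  have hx4 : x ^ 2 * r ^ 4 = 1 := by
    calc x ^ 2 * r ^ 4 = (x * r ^ 2) ^ 2 := by ring
      _ = 1 := by rw [hxr]; norm_num
  set D := 3 * C / γ with hD
  have hD0 : 0 < D := by positivity
  set T := S / f with hT
  have hTf : S = T * f := by rw [hT]; field_simp
  have k1 : |T - (x ^ 2 / 2 - 1)| ≤ D * q := by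
    have e : T - (x ^ 2 / 2 - 1) = ((S - (x ^ 2 / 2 - 1) * g) - (x ^ 2 / 2 - 1) * (f - g)) / f := by
      rw [hT]; field_simp; ring
    rw [e, abs_div, abs_of_pos hf, div_le_iff₀ hf]
    have hx2 : |x ^ 2 / 2 - 1| ≤ x ^ 2 := by rw [abs_le]; constructor <;> nlinarith
    have k : |(x ^ 2 / 2 - 1) * (f - g)| ≤ x ^ 2 * (C * Δ * r ^ 4) := by
      rw [abs_mul]; gcongr
    have hr4 : r ^ 4 ≤ 1 := pow_le_one₀ hr.le hr1
    have hΔ0 : 0 < Δ := by rw [hΔ]; positivity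
    calc _ ≤ 2 * C * Δ * r ^ 4 + x ^ 2 * (C * Δ * r ^ 4) := (abs_sub _ _).trans (add_le_add hS k)
      _ = 2 * C * Δ * r ^ 4 + C * Δ * (x ^ 2 * r ^ 4) := by ring
      _ ≤ 2 * C * Δ * 1 + C * Δ * 1 := by rw [hx4]; gcongr
      _ = D * q * (γ * q) := by rw [hD, hΔ]; field_simp; ring
      _ ≤ D * q * f := by gcongr; linarith
  have k2 : |T| ≤ x ^ 2 + D := by
    have k := abs_le.1 k1
    have k' : D * q ≤ D := by nlinarith
    have hx2 : 1 ≤ x ^ 2 := by nlinarith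
    rw [abs_le]; constructor <;> linarith [k.1, k.2]
  have k3 : |T - x ^ 2 / 2| ≤ 1 + D := by
    have k := abs_le.1 k1
    have k' : D * q ≤ D := by nlinarith
    have hx2 : 1 ≤ x ^ 2 := by nlinarith
    rw [abs_le]; constructor <;> linarith [k.1, k.2]
  have e : S * A / f + b / (2 * x) = T * (A + b * r ^ 6) - b * r ^ 6 * (T - x ^ 2 / 2) := by
    have : b / (2 * x) = b * r ^ 6 * (x ^ 2 / 2) := by
      have : b / (2 * x) = b / (2 * x) * (x ^ 2 * r ^ 4 * (x * r ^ 2)) := by rw [hx4, hxr]; ring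
      rw [this]; field_simp
    rw [this, hTf]; field_simp; ring
  rw [e]
  have hΔr : Δ * r ≤ r ^ 3 := by
    have : Δ * x ≤ 1 := by rw [hΔ]; nlinarith
    calc Δ * r = Δ * r * (x * r ^ 2) := by rw [hxr, mul_one]
      _ = (Δ * x) * r ^ 3 := by ring
      _ ≤ 1 * r ^ 3 := by gcongr
      _ = r ^ 3 := one_mul _
  have hx1 : x ^ 2 + D ≤ (1 + D) * x ^ 2 := by
    have : 1 ≤ x ^ 2 := by nlinarith
    nlinarith
  have m1 : |T * (A + b * r ^ 6)| ≤ (1 + D) * (2 * C * r ^ 3) := by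
    rw [abs_mul]
    calc _ ≤ ((1 + D) * x ^ 2) * (C * (Δ * r ^ 5 + r ^ 7)) := by gcongr; exact k2.trans hx1
      _ = (1 + D) * (C * (Δ * r + r ^ 3)) * (x ^ 2 * r ^ 4) := by ring
      _ = (1 + D) * (C * (Δ * r + r ^ 3)) := by rw [hx4, mul_one]
      _ ≤ (1 + D) * (C * (r ^ 3 + r ^ 3)) := by gcongr
      _ = _ := by ring
  have m2 : |b * r ^ 6 * (T - x ^ 2 / 2)| ≤ 2 * r ^ 3 * (1 + D) := by
    rw [abs_mul, abs_of_nonneg (by positivity : 0 ≤ b * r ^ 6)]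
    have : r ^ 6 ≤ r ^ 3 := pow_le_pow_of_le_one hr.le hr1 (by norm_num)
    gcongr
  calc _ ≤ (1 + D) * (2 * C * r ^ 3) + 2 * r ^ 3 * (1 + D) := (abs_sub _ _).trans (add_le_add m1 m2)
    _ = _ := by ring

lemma pwS {f g S C Δ r x c M : ℝ} (hC : 0 < C) (hr : 0 < r) (hr1 : r ≤ 1) (hxr : x * r ^ 2 = 1)
    (hΔ : 0 < Δ) (hc : 0 < c) (hg : 0 < g) (hf : 0 < f) (hfc : c * Δ * r ^ 6 ≤ f)
    (hS : |S - (x ^ 2 / 2 - 1) * g| ≤ 2 * C * Δ * r ^ 4) (hM : 0 ≤ M) (hgM : x ^ 2 * g ≤ M * f) :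
    |S / f| ≤ M + 2 * C / c * x := by
  have hx : 1 ≤ x := by nlinarith [mul_le_one₀ hr1 hr.le hr1, sq_nonneg r, pow_pos hr 2]
  rw [abs_div, abs_of_pos hf, div_le_iff₀ hf]
  have hx2 : |x ^ 2 / 2 - 1| ≤ x ^ 2 := by rw [abs_le]; constructor <;> nlinarith
  have k : |(x ^ 2 / 2 - 1) * g| ≤ x ^ 2 * g := by rw [abs_mul, abs_of_pos hg]; gcongr
  have : |S| ≤ 2 * C * Δ * r ^ 4 + x ^ 2 * g := by
    calc |S| = |(S - (x ^ 2 / 2 - 1) * g) + (x ^ 2 / 2 - 1) * g| := by ring_nf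
      _ ≤ _ := (abs_add_le _ _).trans (add_le_add hS k)
  have e : 2 * C * Δ * r ^ 4 ≤ 2 * C / c * x * f := by
    calc 2 * C * Δ * r ^ 4 = 2 * C / c * (x * r ^ 2) * (c * Δ * r ^ 4) := by rw [hxr]; field_simp
      _ = 2 * C / c * x * (c * Δ * r ^ 6) := by ring
      _ ≤ _ := by gcongr
  nlinarith

lemma pwB {f g S A C Δ r x c b : ℝ} (hC : 0 < C) (hr : 0 < r) (hr1 : r ≤ 1) (hxr : x * r ^ 2 = 1)
    (hΔ : 0 < Δ) (hΔr : Δ ≤ r) (hc : 0 < c) (hb0 : 0 ≤ b) (hb2 : b ≤ 2)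
    (hg : 0 < g) (hfg : g ≤ f) (hfc : c * Δ * r ^ 6 ≤ f)
    (hS : |S - (x ^ 2 / 2 - 1) * g| ≤ 2 * C * Δ * r ^ 4)
    (hA : |A + b * r ^ 6| ≤ C * (Δ * r ^ 5 + r ^ 7)) :
    |S * A / f| ≤ (1 + 2 * C / c) * (2 + 2 * C) / x := by
  have hx : 1 ≤ x := by nlinarith [mul_le_one₀ hr1 hr.le hr1, sq_nonneg r, pow_pos hr 2]
  have hx0 : 0 < x := by linarith
  have hf : 0 < f := hg.trans_le hfg
  have k1 := pwS hC hr hr1 hxr hΔ hc hg hf hfc hS (sq_nonneg x) (by gcongr)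
  have k2 : |S / f| ≤ (1 + 2 * C / c) * x ^ 2 := by
    have p : 0 < 2 * C / c := by positivity
    have hxx : x ≤ x ^ 2 := by nlinarith
    nlinarith [mul_le_mul_of_nonneg_left hxx p.le]
  have k3 : |A| ≤ (2 + 2 * C) * r ^ 6 := by
    calc |A| = |(A + b * r ^ 6) - b * r ^ 6| := by ring_nf
      _ ≤ C * (Δ * r ^ 5 + r ^ 7) + b * r ^ 6 := by
        refine (abs_sub _ _).trans (add_le_add hA ?_)
        rw [abs_of_nonneg (by positivity)]
      _ ≤ C * (r * r ^ 5 + r ^ 6) + 2 * r ^ 6 := by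
        have : r ^ 7 ≤ r ^ 6 := pow_le_pow_of_le_one hr.le hr1 (by norm_num)
        gcongr
      _ = _ := by ring
  have hr2 : r ^ 2 = 1 / x := by field_simp; linarith
  calc |S * A / f| = |S / f| * |A| := by rw [← abs_mul]; congr 1; ring
    _ ≤ ((1 + 2 * C / c) * x ^ 2) * ((2 + 2 * C) * r ^ 6) := by gcongr
    _ = ((1 + 2 * C / c) * x ^ 2) * ((2 + 2 * C) * (r ^ 2) ^ 3) := by ring
    _ = _ := by rw [hr2]; field_simp

lemma pwC {f g S A C Δ r x c b : ℝ} (hC : 0 < C) (hr : 0 < r) (hr1 : r ≤ 1) (hxr : x * r ^ 2 = 1)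
    (hΔ : 0 < Δ) (hΔr : Δ ≤ 1) (hc : 0 < c) (hb0 : 0 ≤ b) (hb2 : b ≤ 2)
    (hg : 0 < g) (hfg : g ≤ f) (hfc : c * Δ * r ^ 6 ≤ f) (hgx : x ^ 4 * g ≤ 128 * Δ)
    (hS : |S - (x ^ 2 / 2 - 1) * g| ≤ 2 * C * Δ * r ^ 4)
    (hA : |A + b * r ^ 6| ≤ C * (Δ * r ^ 5 + r ^ 7)) :
    |S * A / f| ≤ (128 / c + 2 * C / c) * (2 + 2 * C) * r ^ 3 := by
  have hx : 1 ≤ x := by nlinarith [mul_le_one₀ hr1 hr.le hr1, sq_nonneg r, pow_pos hr 2]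
  have hx0 : 0 < x := by linarith
  have hf : 0 < f := hg.trans_le hfg
  have hgM : x ^ 2 * g ≤ 128 / c * x * f := by
    have e1 : x ^ 2 * g = x ^ 4 * g * r ^ 4 := by
      calc x ^ 2 * g = x ^ 2 * g * (x * r ^ 2) ^ 2 := by rw [hxr]; ring
        _ = _ := by ring
    calc x ^ 2 * g = x ^ 4 * g * r ^ 4 := e1
      _ ≤ 128 * Δ * r ^ 4 := by gcongr
      _ = 128 / c * (x * r ^ 2) * (c * Δ * r ^ 4) := by rw [hxr]; field_simp
      _ = 128 / c * x * (c * Δ * r ^ 6) := by ring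
      _ ≤ _ := by gcongr
  have k1 := pwS hC hr hr1 hxr hΔ hc hg hf hfc hS (by positivity) hgM
  have k2 : |S / f| ≤ (128 / c + 2 * C / c) * x := by linarith
  have k3 : |A| ≤ (2 + 2 * C) * r ^ 5 := by
    calc |A| = |(A + b * r ^ 6) - b * r ^ 6| := by ring_nf
      _ ≤ C * (Δ * r ^ 5 + r ^ 7) + b * r ^ 6 := by
        refine (abs_sub _ _).trans (add_le_add hA ?_)
        rw [abs_of_nonneg (by positivity)]
      _ ≤ C * (1 * r ^ 5 + r ^ 5) + 2 * r ^ 5 := by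
        have : r ^ 7 ≤ r ^ 5 := pow_le_pow_of_le_one hr.le hr1 (by norm_num)
        have : r ^ 6 ≤ r ^ 5 := pow_le_pow_of_le_one hr.le hr1 (by norm_num)
        gcongr
      _ = _ := by ring
  calc |S * A / f| = |S / f| * |A| := by rw [← abs_mul]; congr 1; ring
    _ ≤ ((128 / c + 2 * C / c) * x) * ((2 + 2 * C) * r ^ 5) := by gcongr
    _ = (128 / c + 2 * C / c) * (2 + 2 * C) * r ^ 3 * (x * r ^ 2) := by ring
    _ = _ := by rw [hxr, mul_one]

/-- Integration of a function squeezed near the comparison function. -/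
lemma half_int {h : ℝ → ℝ} {b X x1 K : ℝ} (hX : 1 ≤ X) (hx1 : X ≤ x1) (hK : 0 ≤ K)
    (hm : AEStronglyMeasurable h (volume.restrict (Ioi 0)))
    (h1 : ∀ x ∈ Ioc 0 X, |h x| ≤ K)
    (h2 : ∀ x ∈ Ioc X x1, |h x + b / (2 * x)| ≤ K * x ^ (-(3/2) : ℝ))
    (h3 : ∀ x ∈ Ioc x1 (2 * x1), |h x| ≤ K / x)
    (h4 : ∀ x ∈ Ioi (2 * x1), |h x| ≤ K * x ^ (-(3/2) : ℝ)) :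
    IntegrableOn h (Ioi 0) ∧ |(∫ x in Ioi (0:ℝ), h x) + b / 2 * (Real.log x1 - Real.log X)| ≤ K * (X + 4) := by
  have hX0 : 0 < X := by linarith
  have hx10 : 0 < x1 := by linarith
  let a : ℝ → ℝ := (Ioc X x1).indicator (fun x => -b / 2 * x⁻¹)
  let d1 : ℝ → ℝ := (Ioc 0 X).indicator (fun _ => K)
  let d2 : ℝ → ℝ := (Ioi X).indicator (fun x => K * x ^ (-(3/2) : ℝ))
  let d3 : ℝ → ℝ := (Ioc x1 (2 * x1)).indicator (fun _ => K / x1)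
  have ia0 : IntegrableOn (fun x : ℝ => -b / 2 * x⁻¹) (Ioc X x1) := by
    refine (ContinuousOn.integrableOn_Icc ?_).mono_set Ioc_subset_Icc_self
    refine continuousOn_const.mul (continuousOn_inv₀.mono fun x hx => ?_)
    have : 0 < x := hX0.trans_le hx.1
    exact this.ne'
  have ia : Integrable a := ia0.integrable_indicator measurableSet_Ioc
  have i1 : Integrable d1 := (integrableOn_const (by simp)).integrable_indicator measurableSet_Ioc
  have i20 : IntegrableOn (fun x : ℝ => K * x ^ (-(3/2) : ℝ)) (Ioi X) :=
    (integrableOn_Ioi_rpow_of_lt (by norm_num) hX0).const_mul K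
  have i2 : Integrable d2 := i20.integrable_indicator measurableSet_Ioi
  have i3 : Integrable d3 := (integrableOn_const (by simp)).integrable_indicator measurableSet_Ioc
  have id := (i1.add i2).add i3
  have bd : ∀ x ∈ Ioi (0:ℝ), ‖h x - a x‖ ≤ (d1 + d2 + d3) x := by
    intro x hx
    have hx0 : (0:ℝ) < x := hx
    have p2 : 0 ≤ K * x ^ (-(3/2):ℝ) := by positivity
    have p3 : 0 ≤ K / x1 := by positivity
    have q1 : 0 ≤ d1 x := indicator_nonneg (fun _ _ => hK) x
    have q2 : 0 ≤ d2 x := by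
      refine indicator_nonneg (fun y hy => ?_) x
      have : 0 < y := hX0.trans hy
      positivity
    have q3 : 0 ≤ d3 x := indicator_nonneg (fun _ _ => p3) x
    simp only [Pi.add_apply, Real.norm_eq_abs]
    rcases le_or_gt x X with c1 | c1
    · have e1 : a x = 0 := indicator_of_notMem (fun hh => by linarith [hh.1]) _
      have e2 : d1 x = K := indicator_of_mem (show x ∈ Ioc 0 X from ⟨hx0, c1⟩) _
      rw [e1, sub_zero, e2]
      linarith [h1 x ⟨hx0, c1⟩]
    have e2 : d2 x = K * x ^ (-(3/2):ℝ) := indicator_of_mem (show x ∈ Ioi X from c1) _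
    rcases le_or_gt x x1 with c2 | c2
    · have e1 : a x = -b / 2 * x⁻¹ := indicator_of_mem (show x ∈ Ioc X x1 from ⟨c1, c2⟩) _
      have := h2 x ⟨c1, c2⟩
      have e3 : h x - a x = h x + b / (2 * x) := by rw [e1]; field_simp; ring
      rw [e3, e2]; linarith
    have e1 : a x = 0 := indicator_of_notMem (fun hh => by linarith [hh.2]) _
    rw [e1, sub_zero, e2]
    rcases le_or_gt x (2 * x1) with c3 | c3
    · have e4 : d3 x = K / x1 := indicator_of_mem (show x ∈ Ioc x1 (2 * x1) from ⟨c2, c3⟩) _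
      have := h3 x ⟨c2, c3⟩
      have : K / x ≤ K / x1 := by gcongr
      rw [e4]; linarith
    · have := h4 x c3
      linarith
  have ma : AEStronglyMeasurable (fun x => h x - a x) (volume.restrict (Ioi 0)) := hm.sub ia.integrableOn.aestronglyMeasurable
  have bd' : ∀ᵐ x ∂(volume.restrict (Ioi (0:ℝ))), ‖h x - a x‖ ≤ (d1 + d2 + d3) x :=
    (ae_restrict_iff' measurableSet_Ioi).2 (Eventually.of_forall bd)
  have ih : IntegrableOn (fun x => h x - a x) (Ioi 0) := Integrable.mono' id.integrableOn ma bd'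
  have iall : IntegrableOn h (Ioi 0) := by
    have := ih.add ia.integrableOn
    refine this.congr (Eventually.of_forall fun x => ?_)
    simp
  refine ⟨iall, ?_⟩
  have va : ∫ x in Ioi (0:ℝ), a x = -b / 2 * (Real.log x1 - Real.log X) := by
    rw [setIntegral_indicator measurableSet_Ioc, show Ioi 0 ∩ Ioc X x1 = Ioc X x1 from
      inter_eq_right.2 fun x hx => hX0.trans hx.1, integral_const_mul,
      ← intervalIntegral.integral_of_le hx1, integral_inv_of_pos hX0 hx10, Real.log_div hx10.ne' hX0.ne']
  have v1 : ∫ x in Ioi (0:ℝ), d1 x = K * X := by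
    rw [setIntegral_indicator measurableSet_Ioc, show Ioi 0 ∩ Ioc 0 X = Ioc 0 X from
      inter_eq_right.2 fun x hx => hx.1]
    simp [hX0.le, mul_comm]
  have v3 : ∫ x in Ioi (0:ℝ), d3 x = K := by
    rw [setIntegral_indicator measurableSet_Ioc, show Ioi 0 ∩ Ioc x1 (2 * x1) = Ioc x1 (2 * x1) from
      inter_eq_right.2 fun x hx => hx10.trans hx.1]
    simp only [integral_const, smul_eq_mul, measureReal_restrict_apply_univ, Real.volume_real_Ioc]
    rw [max_eq_left (by linarith)]; field_simp; ring
  have v2 : ∫ x in Ioi (0:ℝ), d2 x ≤ K * 2 := by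
    rw [setIntegral_indicator measurableSet_Ioi, show Ioi 0 ∩ Ioi X = Ioi X from
      inter_eq_right.2 fun x hx => hX0.trans hx, integral_const_mul,
      integral_Ioi_rpow_of_lt (by norm_num) hX0]
    have : X ^ (-(3 / 2) + 1 : ℝ) ≤ 1 := Real.rpow_le_one_of_one_le_of_nonpos hX (by norm_num)
    gcongr
    norm_num at this ⊢
    linarith
  have e : ∫ x in Ioi (0:ℝ), h x = (∫ x in Ioi (0:ℝ), (h x - a x)) + ∫ x in Ioi (0:ℝ), a x := by
    rw [← integral_add ih ia.integrableOn]; simp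
  have key := norm_integral_le_of_norm_le id.integrableOn bd'
  have hs : ∫ x in Ioi (0:ℝ), (d1 + d2 + d3) x = (∫ x in Ioi (0:ℝ), d1 x) + (∫ x in Ioi (0:ℝ), d2 x) + ∫ x in Ioi (0:ℝ), d3 x := by
    rw [integral_add' (i1.add i2).integrableOn i3.integrableOn, integral_add' i1.integrableOn i2.integrableOn]
  rw [e, va]
  rw [Real.norm_eq_abs] at key
  rw [show (∫ x in Ioi (0:ℝ), (h x - a x)) + -b / 2 * (Real.log x1 - Real.log X) + b / 2 * (Real.log x1 - Real.log X)
    = ∫ x in Ioi (0:ℝ), (h x - a x) by ring]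
  linarith

end P6

end Part6

section Part7

section P7

lemma nd_anti {x y : ℝ} (hx : 0 ≤ x) (hxy : x ≤ y) : normalDensity y ≤ normalDensity x := by
  unfold normalDensity
  gcongr

lemma nd_pos (x : ℝ) : 0 < normalDensity x := by
  unfold normalDensity; positivity

/-- bound near the origin -/
lemma pw0 {f S A F x X G : ℝ} (hx : 0 ≤ x) (hxX : x ≤ X) (hG : 0 < G) (hf : G / 2 ≤ f)
    (hS : S = -f - x * F) (hF : |F| ≤ 10 ^ 12) (hA : |A| ≤ 10 ^ 12) :
    |S * A / f| ≤ (1 + X * 10 ^ 12 / (G / 2)) * 10 ^ 12 := by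
  have hf0 : 0 < f := by linarith
  have e : S * A / f = (-1 - x * F / f) * A := by rw [hS]; field_simp
  rw [e, abs_mul]
  refine mul_le_mul ?_ hA (abs_nonneg _) (by have := hx.trans hxX; positivity)
  calc |-1 - x * F / f| ≤ |(-1:ℝ)| + |x * F / f| := abs_sub _ _
    _ = 1 + x * |F| / f := by rw [abs_div, abs_mul, abs_of_nonneg hx, abs_of_pos hf0]; norm_num
    _ ≤ 1 + X * 10 ^ 12 / (G / 2) := by have := hx.trans hxX; gcongr

lemma rp {x : ℝ} (hx : 0 < x) : ∀ n : ℕ, (x ^ (-(1/2) : ℝ)) ^ n = x ^ (-(n / 2) : ℝ) := by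
  intro n
  rw [← Real.rpow_natCast, ← Real.rpow_mul hx.le]; congr 1; ring

lemma loglog_top : Tendsto (fun Δ : ℝ => Real.log (1 / Δ)) (𝓝[>] 0) atTop := by
  have := Real.tendsto_log_atTop.comp (tendsto_inv_nhdsGT_zero (𝕜 := ℝ))
  refine this.congr fun x => ?_
  simp

set_option maxHeartbeats 2000000 in
lemma half (β : ℝ) (hβ : β ∈ Ioo (-1:ℝ) 1) : ∃ K : ℝ, ∀ᶠ Δ in 𝓝[>] (0:ℝ),
    IntegrableOn (fun x => fSig (2 - Δ) β x * fAlpha (2 - Δ) β x / stableDensity (2 - Δ) β x) (Ioi 0) ∧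
    |(∫ x in Ioi (0:ℝ), fSig (2 - Δ) β x * fAlpha (2 - Δ) β x / stableDensity (2 - Δ) β x)
      + (1 + β) / 4 * Real.log (Real.log (1 / Δ))| ≤ K := by
  obtain ⟨C, hC, hT⟩ := est_tail
  have hb : |β| ≤ 1 := abs_le.2 ⟨hβ.1.le, hβ.2.le⟩
  set b := 1 + β with hbdef
  have hb0 : 0 < b := by linarith [hβ.1]
  have hb2 : b ≤ 2 := by linarith [hβ.2]
  set c := b / 4 with hc
  have hc0 : 0 < c := by positivity
  set X := max 1 ((C / c) ^ 2) with hX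
  have hX1 : 1 ≤ X := le_max_left _ _
  have hXc : C ≤ c * Real.sqrt X := by
    have : C / c ≤ Real.sqrt X := Real.le_sqrt_of_sq_le (le_max_right _ _)
    rwa [div_le_iff₀ hc0, mul_comm] at this
  set G := normalDensity X with hG
  have hG0 : 0 < G := nd_pos X
  set γ := 1 / (2 * Real.sqrt Real.pi) with hγ
  have hγ0 : 0 < γ := by positivity
  have hγ1 : γ ≤ 1 := by
    rw [hγ, div_le_one (by positivity)]
    have : 1 ≤ Real.sqrt Real.pi := by
      rw [Real.one_le_sqrt]; linarith [Real.pi_gt_three]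
    linarith
  set K0 := (1 + X * 10 ^ 12 / (G / 2)) * 10 ^ 12 with hK0
  set K1 := 2 * (1 + 3 * C / γ) * (1 + C) with hK1
  set K2 := (1 + 2 * C / c) * (2 + 2 * C) with hK2
  set K3 := (128 / c + 2 * C / c) * (2 + 2 * C) with hK3
  have k0 : 0 < K0 := by positivity
  have k1 : 0 < K1 := by positivity
  have k2 : 0 < K2 := by positivity
  have k3 : 0 < K3 := by positivity
  set K := K0 + K1 + K2 + K3 with hK
  refine ⟨K * (X + 4) + b / 4 * Real.log 2 + b / 2 * Real.log X, ?_⟩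
  have ev : ∀ δ > 0, ∀ᶠ Δ in 𝓝[>] (0:ℝ), Δ < δ := fun δ hδ =>
    nhdsWithin_le_nhds (gt_mem_nhds hδ)
  filter_upwards [hT, ev (1 / 100) (by norm_num), ev (c / C) (by positivity), ev (G / 2 / 10 ^ 12) (by positivity),
    loglog_top.eventually_ge_atTop (X ^ 2), self_mem_nhdsWithin] with Δ hT hΔ1 hΔC hΔG hℓ hΔ0
  replace hΔ0 : 0 < Δ := hΔ0
  have P : Par Δ β := ⟨hΔ0.le, hΔ1.le, hb⟩
  set ℓ := Real.log (1 / Δ) with hℓd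
  have hℓ0 : 0 < ℓ := lt_of_lt_of_le (by positivity) hℓ
  set x1 := Real.sqrt (2 * ℓ) with hx1
  have hx1sq : x1 ^ 2 = 2 * ℓ := Real.sq_sqrt (by positivity)
  have hXx1 : X ≤ x1 := Real.le_sqrt_of_sq_le (by linarith)
  set q := Real.sqrt Δ with hq
  have hqsq : q ^ 2 = Δ := Real.sq_sqrt hΔ0.le
  have hq0 : 0 < q := Real.sqrt_pos.2 hΔ0
  have hqs : q ≤ 1 / 10 := by nlinarith
  have hqe : q = Real.exp (-(ℓ / 2)) := by
    have : q ^ 2 = (Real.exp (-(ℓ / 2))) ^ 2 := by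
      rw [hqsq, ← Real.exp_nat_mul, hℓd, one_div, Real.log_inv]
      rw [show ((2:ℕ):ℝ) * -(-Real.log Δ / 2) = Real.log Δ by push_cast; ring, Real.exp_log hΔ0]
    exact (pow_left_inj₀ hq0.le (Real.exp_pos _).le (by norm_num)).1 this
  have hΔe : Δ = Real.exp (-ℓ) := by
    rw [hℓd, one_div, Real.log_inv, neg_neg, Real.exp_log hΔ0]
  have hqx1 : q * x1 ≤ 1 := by
    have h1 : q * ℓ ≤ 2 := by
      rw [hqe]
      have := Real.add_one_le_exp (ℓ / 2)
      have h2 : Real.exp (-(ℓ / 2)) * Real.exp (ℓ / 2) = 1 := by rw [← Real.exp_add]; simp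
      nlinarith [Real.exp_pos (-(ℓ / 2))]
    have : (q * x1) ^ 2 ≤ 1 := by
      rw [mul_pow, hx1sq]; nlinarith
    exact (sq_le_one_iff₀ (by positivity)).1 this
  -- pointwise facts beyond X
  have tail : ∀ x, X < x → ∃ r : ℝ, 0 < r ∧ r ≤ 1 ∧ x * r ^ 2 = 1 ∧ r ^ 3 = x ^ (-(3/2):ℝ) ∧
      normalDensity x ≤ stableDensity (2 - Δ) β x ∧ c * Δ * r ^ 6 ≤ stableDensity (2 - Δ) β x ∧
      |stableDensity (2 - Δ) β x - normalDensity x| ≤ C * Δ * r ^ 4 ∧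
      |fSig (2 - Δ) β x - (x ^ 2 / 2 - 1) * normalDensity x| ≤ 2 * C * Δ * r ^ 4 ∧
      |fAlpha (2 - Δ) β x + b * r ^ 6| ≤ C * (Δ * r ^ 5 + r ^ 7) := by
    intro x hx
    have hx1 : 1 ≤ x := by linarith
    have hx0 : 0 < x := by linarith
    obtain ⟨t1, t2, t3, t4⟩ := hT β x hb hx1
    set r := x ^ (-(1/2) : ℝ) with hr
    have r0 : 0 < r := by positivity
    have R := rp hx0
    rw [← hr] at R
    have R2 : r ^ 2 = x ^ (-1 : ℝ) := by rw [R]; norm_num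
    have R3 : r ^ 3 = x ^ (-(3/2) : ℝ) := by rw [R]; norm_num
    have R4 : r ^ 4 = x ^ (-2 : ℝ) := by rw [R]; norm_num
    have R5 : r ^ 5 = x ^ (-(5/2) : ℝ) := by rw [R]; norm_num
    have R6 : r ^ 6 = x ^ (-3 : ℝ) := by rw [R]; norm_num
    have R7 : r ^ 7 = x ^ (-(7/2) : ℝ) := by rw [R]; norm_num
    rw [← R4] at t1
    rw [← R6] at t2
    rw [← R6, ← R5, ← R7] at t3
    rw [← R6, ← R7] at t4
    have r1 : r ≤ 1 := Real.rpow_le_one_of_one_le_of_nonpos hx1 (by norm_num)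
    have xr : x * r ^ 2 = 1 := by rw [R2, Real.rpow_neg_one]; field_simp
    have hCr : C * r ≤ c := by
      have h1 : Real.sqrt X * r ≤ 1 := by
        have e : Real.sqrt x * r = 1 := by
          rw [hr, Real.sqrt_eq_rpow, ← Real.rpow_add hx0]; norm_num
        rw [← e]; gcongr
      nlinarith
    have hCΔ : C * Δ ≤ c := by
      rw [lt_div_iff₀ hC] at hΔC; linarith
    have low : normalDensity x + c * Δ * r ^ 6 ≤ stableDensity (2 - Δ) β x := by
      have a1 : C * Δ * (Δ * r ^ 6 + r ^ 7) ≤ 2 * c * Δ * r ^ 6 := by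
        calc C * Δ * (Δ * r ^ 6 + r ^ 7) = (C * Δ + C * r) * (Δ * r ^ 6) := by ring
          _ ≤ (c + c) * (Δ * r ^ 6) := by gcongr
          _ = _ := by ring
      have a2 : 3 / 4 * b * Δ * r ^ 6 = 3 * c * Δ * r ^ 6 := by rw [hc]; ring
      linarith
    have p : 0 < c * Δ * r ^ 6 := by positivity
    refine ⟨r, r0, r1, xr, R3, by linarith, by linarith [nd_pos x], t1, ?_, t3⟩
    have e : fSig (2 - Δ) β x - (x ^ 2 / 2 - 1) * normalDensity x =
      -(stableDensity (2 - Δ) β x - normalDensity x) - x * (fX (2 - Δ) β x + x / 2 * normalDensity x) := by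
      unfold fSig; ring
    rw [e]
    refine (abs_sub _ _).trans ?_
    rw [abs_neg, abs_mul, abs_of_pos hx0]
    calc _ ≤ C * Δ * r ^ 4 + x * (C * Δ * r ^ 6) := by gcongr
      _ = C * Δ * r ^ 4 + (x * r ^ 2) * (C * Δ * r ^ 4) := by ring
      _ = _ := by rw [xr]; ring
  have hm : AEStronglyMeasurable (fun x => fSig (2 - Δ) β x * fAlpha (2 - Δ) β x / stableDensity (2 - Δ) β x)
      (volume.restrict (Ioi 0)) := by
    have m1 := (cont_f P).measurable
    have m2 := (cont_fX P).measurable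
    have m3 := (cont_fAlpha P hΔ0 hΔ1).measurable
    refine Measurable.aestronglyMeasurable ?_
    unfold fSig
    exact (((m1.neg).sub (measurable_id.mul m2)).mul m3).div m1
  have main := half_int (b := b) (K := K) hX1 hXx1 (by positivity) hm ?_ ?_ ?_ ?_
  · refine ⟨main.1, ?_⟩
    have hlog : Real.log x1 = 1 / 2 * (Real.log 2 + Real.log ℓ) := by
      rw [hx1, Real.log_sqrt (by positivity), Real.log_mul (by norm_num) hℓ0.ne']; ring
    have m2 := main.2
    rw [hlog] at m2
    set I := ∫ x in Ioi (0:ℝ), fSig (2 - Δ) β x * fAlpha (2 - Δ) β x / stableDensity (2 - Δ) β x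
    have e : I + b / 4 * Real.log ℓ = (I + b / 2 * (1 / 2 * (Real.log 2 + Real.log ℓ) - Real.log X))
      + (b / 2 * Real.log X - b / 4 * Real.log 2) := by ring
    rw [e]
    refine (abs_add_le _ _).trans ?_
    have : |b / 2 * Real.log X - b / 4 * Real.log 2| ≤ b / 2 * Real.log X + b / 4 * Real.log 2 := by
      have p1 : 0 ≤ b / 2 * Real.log X := mul_nonneg (by positivity) (Real.log_nonneg hX1)
      have p2 : 0 ≤ b / 4 * Real.log 2 := mul_nonneg (by positivity) (Real.log_nonneg (by norm_num))
      rw [abs_le]; constructor <;> linarith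
    linarith
  · intro x hx
    obtain ⟨t1, t2, t3⟩ := est_all P hΔ0 hΔ1 x
    have hf : G / 2 ≤ stableDensity (2 - Δ) β x := by
      have := nd_anti hx.1.le hx.2
      have := (abs_le.1 t1).1
      rw [lt_div_iff₀ (by norm_num)] at hΔG
      linarith
    have := pw0 hx.1.le hx.2 hG0 hf rfl t2 t3
    refine (this : |fSig (2 - Δ) β x * fAlpha (2 - Δ) β x / stableDensity (2 - Δ) β x| ≤ _).trans ?_
    linarith
  · intro x hx
    obtain ⟨r, r0, r1, xr, R3, l1, l2, t1, t2, t3⟩ := tail x hx.1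
    have hx0 : 0 < x := by linarith [hx.1]
    have hg : γ * q ≤ normalDensity x := by
      unfold normalDensity
      rw [hqe]
      gcongr
      have : x ^ 2 ≤ x1 ^ 2 := by have := hx.2; gcongr
      linarith
    have := pwA hC r0 r1 xr hq0 (by linarith) (by nlinarith [hx.2]) hqsq.symm hγ0 hb0.le hb2 hg l1 t1 t2 t3
    refine this.trans ?_
    rw [← R3]
    gcongr
    linarith
  · intro x hx
    obtain ⟨r, r0, r1, xr, R3, l1, l2, t1, t2, t3⟩ := tail x (by linarith [hx.1])
    have hx0 : 0 < x := by linarith [hx.1]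
    have hΔr : Δ ≤ r := by
      have a1 : q * x ≤ 2 := by nlinarith [hx.2]
      have a2 : Δ ^ 2 * x ≤ 1 := by
        rw [← hqsq]
        have : q ^ 3 ≤ (1 / 10) ^ 3 := by gcongr
        calc (q ^ 2) ^ 2 * x = q ^ 3 * (q * x) := by ring
          _ ≤ (1 / 10) ^ 3 * 2 := by gcongr
          _ ≤ 1 := by norm_num
      have a3 : Δ ^ 2 ≤ r ^ 2 := by
        calc Δ ^ 2 = Δ ^ 2 * (x * r ^ 2) := by rw [xr, mul_one]
          _ = Δ ^ 2 * x * r ^ 2 := by ring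
          _ ≤ 1 * r ^ 2 := by gcongr
          _ = _ := one_mul _
      exact (pow_le_pow_iff_left₀ hΔ0.le r0.le (by norm_num)).1 a3
    have := pwB hC r0 r1 xr hΔ0 hΔr hc0 hb0.le hb2 (nd_pos x) l1 l2 t2 t3
    refine this.trans ?_
    gcongr
    linarith
  · intro x hx
    have hx2 : 2 * x1 < x := hx
    have hx0 : 0 < x := by linarith
    obtain ⟨r, r0, r1, xr, R3, l1, l2, t1, t2, t3⟩ := tail x (by linarith)
    have hgx : x ^ 4 * normalDensity x ≤ 128 * Δ := by
      have h8 : 8 * ℓ ≤ x ^ 2 := by nlinarith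
      have a1 : x ^ 4 ≤ 128 * Real.exp (x ^ 2 / 8) := by
        have := Real.quadratic_le_exp_of_nonneg (show 0 ≤ x ^ 2 / 8 by positivity)
        nlinarith [sq_nonneg x]
      have a2 : Real.exp (-(x ^ 2) / 4) = Real.exp (-(x ^ 2 / 8)) * Real.exp (-(x ^ 2 / 8)) := by
        rw [← Real.exp_add]; congr 1; ring
      have a3 : Real.exp (x ^ 2 / 8) * Real.exp (-(x ^ 2 / 8)) = 1 := by rw [← Real.exp_add]; simp
      have a4 : Real.exp (-(x ^ 2 / 8)) ≤ Δ := by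
        rw [hΔe]; gcongr; linarith
      unfold normalDensity
      rw [← hγ, a2]
      calc x ^ 4 * (γ * (Real.exp (-(x ^ 2 / 8)) * Real.exp (-(x ^ 2 / 8))))
          ≤ (128 * Real.exp (x ^ 2 / 8)) * (1 * (Real.exp (-(x ^ 2 / 8)) * Δ)) := by gcongr
        _ = 128 * Δ * (Real.exp (x ^ 2 / 8) * Real.exp (-(x ^ 2 / 8))) := by ring
        _ = _ := by rw [a3, mul_one]
    have := pwC hC r0 r1 xr hΔ0 (by linarith) hc0 hb0.le hb2 (nd_pos x) l1 l2 hgx t2 t3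
    refine this.trans ?_
    rw [← R3]
    gcongr
    linarith

lemma final (β : ℝ) (hβ : β ∈ Set.Ioo (-1 : ℝ) 1) :
    Filter.Tendsto
      (fun Δ : ℝ =>
        (∫ x : ℝ, fSig (2 - Δ) β x * fAlpha (2 - Δ) β x / stableDensity (2 - Δ) β x) /
          Real.log (Real.log (1 / Δ)))
      (nhdsWithin 0 (Set.Ioi 0)) (nhds (-(1 / 2))) := by
  obtain ⟨K, hK⟩ := half β hβ
  obtain ⟨K', hK'⟩ := half (-β) ⟨by linarith [hβ.2], by linarith [hβ.1]⟩
  have hL : Tendsto (fun Δ : ℝ => Real.log (Real.log (1 / Δ))) (𝓝[>] 0) atTop :=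
    Real.tendsto_log_atTop.comp loglog_top
  have hz : Tendsto (fun Δ : ℝ => (K + K') / Real.log (Real.log (1 / Δ))) (𝓝[>] 0) (𝓝 0) :=
    hL.const_div_atTop _
  rw [tendsto_iff_norm_sub_tendsto_zero]
  refine squeeze_zero' (Eventually.of_forall fun _ => norm_nonneg _) ?_ hz
  filter_upwards [hK, hK', hL.eventually_gt_atTop 0] with Δ h1 h2 h3
  set h := fun x => fSig (2 - Δ) β x * fAlpha (2 - Δ) β x / stableDensity (2 - Δ) β x with hh
  have hneg : ∀ x, fSig (2 - Δ) (-β) x * fAlpha (2 - Δ) (-β) x / stableDensity (2 - Δ) (-β) x = h (-x) := by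
    intro x; simp only [hh]; rw [fSig_neg, fAlpha_neg, f_neg]
  simp_rw [hneg] at h2
  have iIic : IntegrableOn h (Iic 0) := by
    rw [integrableOn_Iic_iff_integrableOn_Iio]
    refine ((Measure.measurePreserving_neg (volume : Measure ℝ)).integrableOn_comp_preimage
      (Homeomorph.neg ℝ).measurableEmbedding).1 ?_
    have e : (Neg.neg ⁻¹' Iio 0 : Set ℝ) = Ioi 0 := by ext x; simp
    rw [e]
    exact h2.1
  have es : ∫ x, h x = (∫ x in Ioi (0:ℝ), h x) + ∫ x in Ioi (0:ℝ), h (-x) := by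
    rw [integral_comp_neg_Ioi, neg_zero, add_comm]
    rw [← setIntegral_union (Set.Iic_disjoint_Ioi le_rfl) measurableSet_Ioi iIic h1.1]
    simp
  set L := Real.log (Real.log (1 / Δ))
  have b1 := h1.2
  have b2 := h2.2
  rw [es, Real.norm_eq_abs]
  set I := ∫ x in Ioi (0:ℝ), h x
  set I' := ∫ x in Ioi (0:ℝ), h (-x)
  have e : (I + I') / L - -(1 / 2) = ((I + (1 + β) / 4 * L) + (I' + (1 + -β) / 4 * L)) / L := by
    field_simp; ring
  rw [e, abs_div, abs_of_pos h3]
  gcongr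
  exact (abs_add_le _ _).trans (add_le_add b1 b2)
end P7

end Part7

theorem fisher_information_sigma_alpha (β : ℝ) (hβ : β ∈ Set.Ioo (-1 : ℝ) 1) :
    Filter.Tendsto
      (fun Δ : ℝ =>
        (∫ x : ℝ, fSig (2 - Δ) β x * fAlpha (2 - Δ) β x / stableDensity (2 - Δ) β x) /
          Real.log (Real.log (1 / Δ)))
      (nhdsWithin 0 (Set.Ioi 0)) (nhds (-(1 / 2))) := by
  exact final β hβ
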